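/- Let (V,E,Ψ) be a strongly connected planar box-like self-affine GIFS satisfying the ROSC in which every T_e is diagonal, and let (X_v)_{v∈V} be the associated graph-directed self-affine carpet family. Choose any positive weights (p_e) with ∑_{e:i(e)=v} p_e=1 for every v, defining τ_A, τ_B, γ_A, γ_B. Then for every v∈V the box dimension of X_v exists and dim_B X_v = max{γ_A(0), γ_B(0)}. -/

import Mathlib

open MeasureTheory Filter Set
open scoped Classical

noncomputable section

namespace LqGIFS

/-! ### Mesh cubes, moment sums, L^q spectra, box dimension -/

/-- Closed cube of the `δ`-mesh of `ℝ`. -/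
def meshCube1 (δ : ℝ) (k : ℤ) : Set ℝ := Set.Icc ((k : ℝ) * δ) (((k : ℝ) + 1) * δ)

/-- Closed cube of the `δ`-mesh of `ℝ²`. -/
def meshCube2 (δ : ℝ) (k : ℤ × ℤ) : Set (ℝ × ℝ) :=
  (Set.Icc ((k.1 : ℝ) * δ) (((k.1 : ℝ) + 1) * δ)) ×ˢ
    (Set.Icc ((k.2 : ℝ) * δ) (((k.2 : ℝ) + 1) * δ))

/-- The moment sum `D_δ^q(ν)` for a measure on `ℝ` (cubes of zero measure are omitted,
so that at `q = 0` this counts the mesh cubes of positive measure). -/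
def Dq1 (ν : Measure ℝ) (δ q : ℝ) : ℝ :=
  ∑' k : ℤ, if ν (meshCube1 δ k) = 0 then 0 else (ν (meshCube1 δ k)).toReal ^ q

/-- The moment sum `D_δ^q(ν)` for a measure on `ℝ²`. -/
def Dq2 (ν : Measure (ℝ × ℝ)) (δ q : ℝ) : ℝ :=
  ∑' k : ℤ × ℤ, if ν (meshCube2 δ k) = 0 then 0 else (ν (meshCube2 δ k)).toReal ^ q

/-- The `L^q`-spectrum of a measure on `ℝ` exists and equals `s` (i.e. upper and lower
`L^q`-spectra coincide and equal `s`). -/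
def HasLq1 (ν : Measure ℝ) (q s : ℝ) : Prop :=
  Tendsto (fun δ : ℝ => Real.log (Dq1 ν δ q) / (-Real.log δ))
    (nhdsWithin 0 (Set.Ioi 0)) (nhds s)

/-- The `L^q`-spectrum of a measure on `ℝ²` exists and equals `s`. -/
def HasLq2 (ν : Measure (ℝ × ℝ)) (q s : ℝ) : Prop :=
  Tendsto (fun δ : ℝ => Real.log (Dq2 ν δ q) / (-Real.log δ))
    (nhdsWithin 0 (Set.Ioi 0)) (nhds s)

/-- Number of closed `δ`-mesh cubes of `ℝ²` meeting `X`. -/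
def boxCount (X : Set (ℝ × ℝ)) (δ : ℝ) : ℕ :=
  Set.ncard {k : ℤ × ℤ | (X ∩ meshCube2 δ k).Nonempty}

/-- The box dimension of `X` exists and equals `d`. -/
def HasBoxDim (X : Set (ℝ × ℝ)) (d : ℝ) : Prop :=
  Tendsto (fun δ : ℝ => Real.log (boxCount X δ) / (-Real.log δ))
    (nhdsWithin 0 (Set.Ioi 0)) (nhds d)

/-! ### Matrices: 1-norm, spectral radius, permutation matrices -/

/-- The 1-norm `‖A‖ = ∑_{i,j} |a_{ij}|` of a square matrix. -/
def mnorm {ι : Type*} [Fintype ι] (A : Matrix ι ι ℝ) : ℝ := ∑ i, ∑ j, |A i j|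

/-- The spectral radius of a square real matrix, via the Gelfand formula. -/
def specRad {ι : Type*} [Fintype ι] [DecidableEq ι] (A : Matrix ι ι ℝ) : ℝ :=
  Filter.limsup (fun k : ℕ => (mnorm (A ^ k)) ^ ((k : ℝ)⁻¹)) Filter.atTop

/-- A square 0-1 matrix with exactly one 1 in each row and each column. -/
def IsPermMatrix {ι : Type*} (Z : Matrix ι ι ℝ) : Prop :=
  (∀ i j, Z i j = 0 ∨ Z i j = 1) ∧ (∀ i, ∃! j, Z i j = 1) ∧ (∀ j, ∃! i, Z i j = 1)

/-! ### Directed graphs -/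

/-- Strong connectivity of the finite directed graph with edge set `E`,
initial vertex map `ini` and terminal vertex map `ter`. -/
def GraphSC {V E : Type*} (ini ter : E → V) : Prop :=
  ∀ v v' : V, Relation.TransGen (fun u u' : V => ∃ e, ini e = u ∧ ter e = u') v v'

/-- The matrix `F^{(q)}_{x,y}` with entry `p_{e'}^q a_{e'}^x b_{e'}^y` at `(e,e')` when
`t(e) = i(e')`, and `0` otherwise. -/
def FmatG {V E : Type*} (ini ter : E → V) (p a b : E → ℝ) (q x y : ℝ) :
    Matrix E E ℝ :=
  fun e e' => if ter e = ini e' then p e' ^ q * a e' ^ x * b e' ^ y else 0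

/-- `f` is the entrywise product of the normalized left and right Perron vectors of the
irreducible matrix `F^{(q)}_{x,y(x)}` (spectral radius 1). -/
def IsPerronData {V E : Type*} [Fintype E] [DecidableEq E] (ini ter : E → V)
    (p a b : E → ℝ) (q x yx : ℝ) (f : E → ℝ) : Prop :=
  specRad (FmatG ini ter p a b q x yx) = 1 ∧
  ∃ u v : E → ℝ, (∀ e, 0 < u e) ∧ (∀ e, 0 < v e) ∧ (∑ e, u e) = 1 ∧
    (FmatG ini ter p a b q x yx).mulVec u = u ∧
    (FmatG ini ter p a b q x yx).vecMul v = v ∧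
    (∑ e, v e * u e) = 1 ∧ (∀ e, f e = v e * u e)

/-! ### Planar box-like graph-directed self-affine systems -/

/-- A planar box-like self-affine GIFS: a finite directed graph together with, for each
edge `e`, a contraction `ψ_e(z) = T_e z + t_e` whose linear part is the diagonal matrix
`diag(±a_e, ±b_e)` (when `diag e = true`) or the anti-diagonal matrix with entries
`±a_e` (top right) and `±b_e` (bottom left) (when `diag e = false`), `0 < a_e, b_e < 1`. -/
structure BoxLikeGIFS (V E : Type*) where
  init : E → V
  term : E → V
  a : E → ℝ
  b : E → ℝ
  sa : E → ℝ
  sb : E → ℝ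
  diag : E → Bool
  trans : E → ℝ × ℝ
  a_mem : ∀ e, a e ∈ Set.Ioo (0 : ℝ) 1
  b_mem : ∀ e, b e ∈ Set.Ioo (0 : ℝ) 1
  sa_mem : ∀ e, sa e = 1 ∨ sa e = -1
  sb_mem : ∀ e, sb e = 1 ∨ sb e = -1
  edge_exists : ∀ v, ∃ e, init e = v

namespace BoxLikeGIFS

variable {V E : Type*}

/-- The contraction `ψ_e`. -/
def map (S : BoxLikeGIFS V E) (e : E) : ℝ × ℝ → ℝ × ℝ := fun z =>
  if S.diag e then
    (S.sa e * S.a e * z.1 + (S.trans e).1, S.sb e * S.b e * z.2 + (S.trans e).2)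
  else
    (S.sa e * S.a e * z.2 + (S.trans e).1, S.sb e * S.b e * z.1 + (S.trans e).2)

def StronglyConnected (S : BoxLikeGIFS V E) : Prop := GraphSC S.init S.term

/-- The open unit square `(0,1)²`. -/
def unitSq : Set (ℝ × ℝ) := Set.Ioo (0 : ℝ) 1 ×ˢ Set.Ioo (0 : ℝ) 1

/-- The rectangular open set condition. -/
def ROSC (S : BoxLikeGIFS V E) : Prop :=
  (∀ e : E, S.map e '' unitSq ⊆ unitSq) ∧
  ∀ e e' : E, e ≠ e' → S.init e = S.init e' →
    Disjoint (S.map e '' unitSq) (S.map e' '' unitSq)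

/-- Positive weights summing to one at each vertex. -/
def IsWeights [Fintype E] (S : BoxLikeGIFS V E) (p : E → ℝ) : Prop :=
  (∀ e, 0 < p e) ∧ ∀ v : V, (∑ e : E, if S.init e = v then p e else 0) = 1

/-- `μ` is the associated graph-directed box-like self-affine measure family. -/
def IsGDMeasure [Fintype E] (S : BoxLikeGIFS V E) (p : E → ℝ)
    (μ : V → Measure (ℝ × ℝ)) : Prop :=
  (∀ v, IsProbabilityMeasure (μ v)) ∧
  ∀ v : V, μ v =
    ∑ e : E, if S.init e = v then
      ENNReal.ofReal (p e) • ((μ (S.term e)).map (S.map e)) else (0 : Measure (ℝ × ℝ))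

/-- `X` is the associated graph-directed self-affine carpet family. -/
def IsGDAttractor (S : BoxLikeGIFS V E) (X : V → Set (ℝ × ℝ)) : Prop :=
  (∀ v, (X v).Nonempty ∧ IsCompact (X v)) ∧
  ∀ v : V, X v = ⋃ e : E, ⋃ _ : S.init e = v, S.map e '' X (S.term e)

/-- The matrix `F^{(q)}_{x,y}` of the system. -/
def Fmat (S : BoxLikeGIFS V E) (p : E → ℝ) (q x y : ℝ) : Matrix E E ℝ :=
  FmatG S.init S.term p S.a S.b q x y

/-- The `(2#E) × (2#E)` block matrix `𝒢^{(q)}_{x,y}`, indexed by `E × Bool`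
(`false` = first index of the block, `true` = second). -/
def Gmat (S : BoxLikeGIFS V E) (p : E → ℝ) (τx τy : V → ℝ) (q x y : ℝ) :
    Matrix (E × Bool) (E × Bool) ℝ := fun i j =>
  if S.term i.1 = S.init j.1 then
    if S.diag j.1 then
      if i.2 = false ∧ j.2 = false then
        p j.1 ^ q * S.a j.1 ^ (x + τx (S.term j.1)) * S.b j.1 ^ (y - τx (S.term j.1))
      else if i.2 = true ∧ j.2 = true then
        p j.1 ^ q * S.b j.1 ^ (x + τy (S.term j.1)) * S.a j.1 ^ (y - τy (S.term j.1))
      else 0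
    else
      if i.2 = false ∧ j.2 = true then
        p j.1 ^ q * S.a j.1 ^ (x + τy (S.term j.1)) * S.b j.1 ^ (y - τy (S.term j.1))
      else if i.2 = true ∧ j.2 = false then
        p j.1 ^ q * S.b j.1 ^ (x + τx (S.term j.1)) * S.a j.1 ^ (y - τx (S.term j.1))
      else 0
  else 0

/-! ### Words -/

/-- An admissible word: consecutive edges are composable. -/
def Admissible (S : BoxLikeGIFS V E) (w : List E) : Prop :=
  List.Chain' (fun e e' => S.term e = S.init e') w

/-- `(c_w, d_w)`: width and height of the rectangle `ψ_w([0,1]²)`. -/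
def wdims (S : BoxLikeGIFS V E) : List E → ℝ × ℝ
  | [] => (1, 1)
  | e :: w =>
      if S.diag e then (S.a e * (wdims S w).1, S.b e * (wdims S w).2)
      else (S.a e * (wdims S w).2, S.b e * (wdims S w).1)

/-- Whether `T_w` is diagonal (`true`) or anti-diagonal (`false`). -/
def wordDiag (S : BoxLikeGIFS V E) : List E → Bool
  | [] => true
  | e :: w => S.diag e == wordDiag S w

/-- The larger singular value `α₁(w) = max(c_w, d_w)` of `T_w`. -/
def alpha1 (S : BoxLikeGIFS V E) (w : List E) : ℝ := max (S.wdims w).1 (S.wdims w).2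

/-- The smaller singular value `α₂(w) = min(c_w, d_w)` of `T_w`. -/
def alpha2 (S : BoxLikeGIFS V E) (w : List E) : ℝ := min (S.wdims w).1 (S.wdims w).2

/-- Initial vertex of a (nonempty) word. -/
def wordInit [Nonempty V] (S : BoxLikeGIFS V E) (w : List E) : V :=
  (w.head?.map S.init).getD (Classical.arbitrary V)

/-- Terminal vertex of a (nonempty) word. -/
def wordTerm [Nonempty V] (S : BoxLikeGIFS V E) (w : List E) : V :=
  (w.getLast?.map S.term).getD (Classical.arbitrary V)

/-- `p_w = p_{w_1} ⋯ p_{w_k}`. -/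
def wordProb (p : E → ℝ) (w : List E) : ℝ := (w.map p).prod

/-- `τ_w(q)`: given the values `τx v`, `τy v` of the `L^q`-spectra of the two coordinate
projections of `μ_v`, this is the `L^q`-spectrum of the projection of `μ_{t(w)} ∘ ψ_w⁻¹`
onto the longest side of `ψ_w([0,1]²)`, i.e. `τx (t w)` if `π_w = π_x` and `τy (t w)`
otherwise. -/
def wordTau [Nonempty V] (S : BoxLikeGIFS V E) (τx τy : V → ℝ) (w : List E) : ℝ :=
  if ((S.wdims w).2 ≤ (S.wdims w).1 ↔ S.wordDiag w = true) then τx (S.wordTerm w)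
  else τy (S.wordTerm w)

/-- The modified singular value function
`φ^{s,q}(w) = p_w^q α₁(w)^{τ_w(q)} α₂(w)^{s - τ_w(q)}`. -/
def msvf [Nonempty V] (S : BoxLikeGIFS V E) (p : E → ℝ) (τx τy : V → ℝ)
    (s q : ℝ) (w : List E) : ℝ :=
  wordProb p w ^ q * S.alpha1 w ^ (S.wordTau τx τy w) *
    S.alpha2 w ^ (s - S.wordTau τx τy w)

/-- The modified singular value function matrix `A_k^{s,q}`. -/
def Amat [Nonempty V] [Fintype E] (S : BoxLikeGIFS V E) (p : E → ℝ) (τx τy : V → ℝ)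
    (s q : ℝ) (k : ℕ) : Matrix V V ℝ := fun v v' =>
  ∑ f : Fin k → E,
    if S.Admissible (List.ofFn f) ∧ S.wordInit (List.ofFn f) = v ∧
        S.wordTerm (List.ofFn f) = v'
    then S.msvf p τx τy s q (List.ofFn f) else 0

/-- The family `E^*_δ` of admissible words whose shortest side drops below `δ`
exactly at the last letter. -/
def EstarDelta (S : BoxLikeGIFS V E) (δ : ℝ) : Set (List E) :=
  {w | w ≠ [] ∧ S.Admissible w ∧ S.alpha2 w < δ ∧ δ ≤ S.alpha2 w.dropLast}

end BoxLikeGIFS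

/-! ### Partition of the projections, for the splitting proposition -/

/-- The projection family: `(v, false) ↦ μ_v^x` and `(v, true) ↦ μ_v^y`. -/
def projMeas {V : Type*} (μ : V → Measure (ℝ × ℝ)) (i : V × Bool) : Measure ℝ :=
  if i.2 then (μ i.1).map Prod.snd else (μ i.1).map Prod.fst

/-- `A`, `B` is a partition of the projection family `{μ_v^x, μ_v^y}_v` into two disjoint
families of cardinality `#V`, on each of which the `L^q`-spectra exist and share a common
value, and which splits `{μ_v^x, μ_v^y}` for each `v`. -/
def GoodPartition {V : Type*} [Fintype V] (μ : V → Measure (ℝ × ℝ))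
    (A B : Finset (V × Bool)) : Prop :=
  Disjoint A B ∧ A ∪ B = Finset.univ ∧
  A.card = Fintype.card V ∧ B.card = Fintype.card V ∧
  ∃ τA τB : ℝ → ℝ,
    (∀ q : ℝ, 0 ≤ q → ∀ i ∈ A, HasLq1 (projMeas μ i) q (τA q)) ∧
    (∀ q : ℝ, 0 ≤ q → ∀ i ∈ B, HasLq1 (projMeas μ i) q (τB q)) ∧
    ∀ v : V, ((v, false) ∈ A ∧ (v, true) ∈ B) ∨ ((v, false) ∈ B ∧ (v, true) ∈ A)

end LqGIFS

end

namespace LqGIFS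

noncomputable section

/-! ### Counting mesh intervals and mesh rectangles -/

/-- Indices of the closed `δ`-mesh intervals meeting `Y`. -/
def meshIdx (Y : Set ℝ) (δ : ℝ) : Set ℤ := {k | (Y ∩ meshCube1 δ k).Nonempty}

/-- Indices of the closed `δ₁ × δ₂`-mesh rectangles meeting `Y`. -/
def rectIdx (Y : Set (ℝ × ℝ)) (δ₁ δ₂ : ℝ) : Set (ℤ × ℤ) :=
  {k | (Y ∩ (meshCube1 δ₁ k.1 ×ˢ meshCube1 δ₂ k.2)).Nonempty}

theorem boxCount_eq_ncard (Y : Set (ℝ × ℝ)) (δ : ℝ) :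
    boxCount Y δ = (rectIdx Y δ δ).ncard := rfl

theorem exists_mem_meshCube1 {δ : ℝ} (hδ : 0 < δ) (x : ℝ) : ∃ k : ℤ, x ∈ meshCube1 δ k := by
  refine ⟨⌊x / δ⌋, ?_, ?_⟩
  · have := Int.floor_le (x / δ)
    rwa [le_div_iff₀ hδ] at this
  · have := (Int.lt_floor_add_one (x / δ)).le
    rwa [div_le_iff₀ hδ] at this

theorem meshIdx_subset_Icc {Y : Set ℝ} {δ α β : ℝ} (hδ : 0 < δ) (hY : Y ⊆ Icc α β) :
    meshIdx Y δ ⊆ Icc (⌊α / δ⌋ - 1) ⌊β / δ⌋ := by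
  rintro k ⟨x, hxY, hx1, hx2⟩
  have h1 := (hY hxY).1
  have h2 := (hY hxY).2
  constructor
  · have : α / δ ≤ ((k + 1 : ℤ) : ℝ) := by
      rw [div_le_iff₀ hδ]; push_cast; linarith
    have := Int.floor_le_floor this
    rw [Int.floor_intCast] at this
    omega
  · rw [Int.le_floor, le_div_iff₀ hδ]; linarith

theorem meshIdx_finite {Y : Set ℝ} {δ α β : ℝ} (hδ : 0 < δ) (hY : Y ⊆ Icc α β) :
    (meshIdx Y δ).Finite :=
  (Set.finite_Icc _ _).subset (meshIdx_subset_Icc hδ hY)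

theorem meshIdx_ncard_le {Y : Set ℝ} {δ α β : ℝ} (hδ : 0 < δ) (hαβ : α ≤ β)
    (hY : Y ⊆ Icc α β) : ((meshIdx Y δ).ncard : ℝ) ≤ (β - α) / δ + 3 := by
  have h1 : (meshIdx Y δ).ncard ≤ (⌊β / δ⌋ + 1 - (⌊α / δ⌋ - 1)).toNat := by
    rw [← Int.card_Icc, ← Set.ncard_coe_finset, Finset.coe_Icc]
    exact Set.ncard_le_ncard (meshIdx_subset_Icc hδ hY) (Set.finite_Icc _ _)
  have h0 : ⌊α / δ⌋ ≤ ⌊β / δ⌋ := Int.floor_le_floor (by gcongr)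
  have h2 : ((meshIdx Y δ).ncard : ℝ) ≤ ((⌊β / δ⌋ + 1 - (⌊α / δ⌋ - 1) : ℤ) : ℝ) := by
    have : ((meshIdx Y δ).ncard : ℤ) ≤ ⌊β / δ⌋ + 1 - (⌊α / δ⌋ - 1) := by omega
    exact_mod_cast this
  push_cast at h2
  have h3 := Int.floor_le (β / δ)
  have h4 := Int.lt_floor_add_one (α / δ)
  rw [sub_div]
  linarith

theorem meshIdx_ncard_le_three {Y : Set ℝ} {δ t : ℝ} (hδ : 0 < δ) (hY : Y ⊆ Icc t (t + δ)) :
    (meshIdx Y δ).ncard ≤ 3 := by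
  have h1 : (meshIdx Y δ).ncard ≤ (⌊(t + δ) / δ⌋ + 1 - (⌊t / δ⌋ - 1)).toNat := by
    rw [← Int.card_Icc, ← Set.ncard_coe_finset, Finset.coe_Icc]
    exact Set.ncard_le_ncard (meshIdx_subset_Icc hδ hY) (Set.finite_Icc _ _)
  rw [add_div, div_self hδ.ne', Int.floor_add_one] at h1
  omega

theorem ncard_le_ncard_mul {ι κ : Type*} {A : Set ι} {K : Set κ} (B : κ → Set ι) (M : ℕ)
    (hK : K.Finite) (hB : ∀ k ∈ K, (B k).Finite) (hM : ∀ k ∈ K, (B k).ncard ≤ M)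
    (hA : ∀ x ∈ A, ∃ k ∈ K, x ∈ B k) : A.ncard ≤ K.ncard * M := by
  have hsub : A ⊆ ⋃ k ∈ K, B k := fun x hx => by simpa using hA x hx
  have hfin : (⋃ k ∈ K, B k).Finite := hK.biUnion hB
  refine (Set.ncard_le_ncard hsub hfin).trans ?_
  lift K to Finset κ using hK
  rw [Set.ncard_coe_finset]
  have : (⋃ k ∈ (K : Set κ), B k) =
      ((K.biUnion fun k => if h : (B k).Finite then h.toFinset else ∅ : Finset ι) : Set ι) := by
    ext x
    simp only [Set.mem_iUnion, Finset.coe_biUnion]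
    refine exists_congr fun k => exists_congr fun hk => ?_
    simp [hB k hk]
  rw [this, Set.ncard_coe_finset]
  refine Finset.card_biUnion_le_card_mul _ _ _ fun k hk => ?_
  rw [dif_pos (hB k hk), ← Set.ncard_eq_toFinset_card _ (hB k hk)]
  exact hM k hk

theorem meshIdx_image_ncard_le {Y : Set ℝ} {δ α β u : ℝ} (t : ℝ) (hδ : 0 < δ) (hu : u ≠ 0)
    (hY : Y ⊆ Icc α β) :
    (meshIdx ((fun x => u * x + t) '' Y) δ).ncard ≤ (meshIdx Y (δ / |u|)).ncard * 3 := by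
  have hu' : 0 < |u| := abs_pos.mpr hu
  have hcell : ∀ k : ℤ, (fun x => u * x + t) '' meshCube1 (δ / |u|) k ⊆
      Icc (u * ((k + 1 / 2) * (δ / |u|)) + t - δ / 2)
        (u * ((k + 1 / 2) * (δ / |u|)) + t - δ / 2 + δ) := by
    rintro k _ ⟨x, ⟨hx1, hx2⟩, rfl⟩
    have h1 : |x - (k + 1 / 2) * (δ / |u|)| ≤ δ / |u| / 2 := by
      rw [abs_le]; constructor <;> linarith
    have h2 : |u * x - u * ((k + 1 / 2) * (δ / |u|))| ≤ δ / 2 := by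
      rw [← mul_sub, abs_mul]
      calc |u| * |x - (k + 1 / 2) * (δ / |u|)| ≤ |u| * (δ / |u| / 2) := by gcongr
        _ = δ / 2 := by field_simp
    rw [abs_le] at h2
    constructor <;> simp only <;> linarith [h2.1, h2.2]
  refine ncard_le_ncard_mul
    (fun k => meshIdx ((fun x => u * x + t) '' meshCube1 (δ / |u|) k) δ) 3
    (meshIdx_finite (by positivity) hY) (fun k _ => meshIdx_finite hδ (hcell k))
    (fun k _ => meshIdx_ncard_le_three hδ (hcell k)) ?_
  rintro j ⟨_, ⟨x, hxY, rfl⟩, hj⟩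
  obtain ⟨k, hk⟩ := exists_mem_meshCube1 (δ := δ / |u|) (by positivity) x
  exact ⟨k, ⟨x, hxY, hk⟩, _, ⟨x, hk, rfl⟩, hj⟩

theorem meshIdx_ncard_le_image {Y : Set ℝ} {δ α β u : ℝ} (t : ℝ) (hδ : 0 < δ) (hu : u ≠ 0)
    (hY : (fun x => u * x + t) '' Y ⊆ Icc α β) :
    (meshIdx Y (δ / |u|)).ncard ≤ (meshIdx ((fun x => u * x + t) '' Y) δ).ncard * 3 := by
  have hu' : 0 < |u| := abs_pos.mpr hu
  have h := meshIdx_image_ncard_le (δ := δ / |u|) (u := u⁻¹) (-(u⁻¹ * t)) (by positivity)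
    (inv_ne_zero hu) hY
  rw [Set.image_image, abs_inv, div_inv_eq_mul, div_mul_cancel₀ _ hu'.ne'] at h
  have hid : (fun x => u⁻¹ * (u * x + t) + -(u⁻¹ * t)) '' Y = Y := by
    have : (fun x => u⁻¹ * (u * x + t) + -(u⁻¹ * t)) = id := by
      funext x; simp only [id]; field_simp; ring
    rw [this, Set.image_id]
  rwa [hid] at h

theorem rectIdx_subset_prod (Y : Set (ℝ × ℝ)) (δ₁ δ₂ : ℝ) :
    rectIdx Y δ₁ δ₂ ⊆ meshIdx (Prod.fst '' Y) δ₁ ×ˢ meshIdx (Prod.snd '' Y) δ₂ := by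
  rintro ⟨k, l⟩ ⟨z, hz, h1, h2⟩
  exact ⟨⟨z.1, ⟨z, hz, rfl⟩, h1⟩, ⟨z.2, ⟨z, hz, rfl⟩, h2⟩⟩

theorem rectIdx_finite {Y : Set (ℝ × ℝ)} {δ₁ δ₂ : ℝ} (h1 : 0 < δ₁) (h2 : 0 < δ₂)
    (hY : Y ⊆ Icc 0 1 ×ˢ Icc 0 1) : (rectIdx Y δ₁ δ₂).Finite := by
  refine Set.Finite.subset ((meshIdx_finite (α := 0) (β := 1) h1 ?_).prod
    (meshIdx_finite (α := 0) (β := 1) h2 ?_)) (rectIdx_subset_prod Y δ₁ δ₂)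
  · rintro _ ⟨z, hz, rfl⟩; exact (hY hz).1
  · rintro _ ⟨z, hz, rfl⟩; exact (hY hz).2

theorem rectIdx_ncard_le_mul {Y : Set (ℝ × ℝ)} {δ₁ δ₂ : ℝ} (h1 : 0 < δ₁) (h2 : 0 < δ₂)
    (hY : Y ⊆ Icc 0 1 ×ˢ Icc 0 1) : (rectIdx Y δ₁ δ₂).ncard ≤
      (meshIdx (Prod.fst '' Y) δ₁).ncard * (meshIdx (Prod.snd '' Y) δ₂).ncard := by
  rw [← Set.ncard_prod]
  refine Set.ncard_le_ncard (rectIdx_subset_prod Y δ₁ δ₂)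
    ((meshIdx_finite (α := 0) (β := 1) h1 ?_).prod (meshIdx_finite (α := 0) (β := 1) h2 ?_))
  · rintro _ ⟨z, hz, rfl⟩; exact (hY hz).1
  · rintro _ ⟨z, hz, rfl⟩; exact (hY hz).2

theorem meshIdx_fst_ncard_le {Y : Set (ℝ × ℝ)} {δ₁ δ₂ : ℝ} (h1 : 0 < δ₁) (h2 : 0 < δ₂)
    (hY : Y ⊆ Icc 0 1 ×ˢ Icc 0 1) :
    (meshIdx (Prod.fst '' Y) δ₁).ncard ≤ (rectIdx Y δ₁ δ₂).ncard := by
  have hfin := rectIdx_finite h1 h2 hY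
  refine (Set.ncard_le_ncard ?_ (hfin.image Prod.fst)).trans (Set.ncard_image_le hfin)
  rintro k ⟨_, ⟨z, hz, rfl⟩, hk⟩
  obtain ⟨l, hl⟩ := exists_mem_meshCube1 h2 z.2
  exact ⟨(k, l), ⟨z, hz, hk, hl⟩, rfl⟩

theorem meshIdx_snd_ncard_le {Y : Set (ℝ × ℝ)} {δ₁ δ₂ : ℝ} (h1 : 0 < δ₁) (h2 : 0 < δ₂)
    (hY : Y ⊆ Icc 0 1 ×ˢ Icc 0 1) :
    (meshIdx (Prod.snd '' Y) δ₂).ncard ≤ (rectIdx Y δ₁ δ₂).ncard := by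
  have hfin := rectIdx_finite h1 h2 hY
  refine (Set.ncard_le_ncard ?_ (hfin.image Prod.snd)).trans (Set.ncard_image_le hfin)
  rintro k ⟨_, ⟨z, hz, rfl⟩, hk⟩
  obtain ⟨l, hl⟩ := exists_mem_meshCube1 h1 z.1
  exact ⟨(l, k), ⟨z, hz, hl, hk⟩, rfl⟩

theorem rectIdx_ncard_pos {Y : Set (ℝ × ℝ)} {δ₁ δ₂ : ℝ} (h1 : 0 < δ₁) (h2 : 0 < δ₂)
    (hY : Y ⊆ Icc 0 1 ×ˢ Icc 0 1) (hne : Y.Nonempty) : 0 < (rectIdx Y δ₁ δ₂).ncard := by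
  rw [Set.ncard_pos (rectIdx_finite h1 h2 hY)]
  obtain ⟨z, hz⟩ := hne
  obtain ⟨k, hk⟩ := exists_mem_meshCube1 h1 z.1
  obtain ⟨l, hl⟩ := exists_mem_meshCube1 h2 z.2
  exact ⟨(k, l), z, hz, hk, hl⟩

theorem rectIdx_mono {Y Z : Set (ℝ × ℝ)} (h : Y ⊆ Z) (δ₁ δ₂ : ℝ) :
    rectIdx Y δ₁ δ₂ ⊆ rectIdx Z δ₁ δ₂ := fun _ ⟨z, hz, hk⟩ => ⟨z, h hz, hk⟩

/-! ### Pieces: diagonal affine copies -/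

/-- The diagonal affine map `(x, y) ↦ (u x + tx, w y + ty)` together with a vertex. -/
structure Piece (V : Type*) where
  u : ℝ
  tx : ℝ
  w : ℝ
  ty : ℝ
  vtx : V

namespace Piece

variable {V E : Type*}

/-- The affine map of a piece. -/
def map (P : Piece V) (z : ℝ × ℝ) : ℝ × ℝ := (P.u * z.1 + P.tx, P.w * z.2 + P.ty)

/-- The open rectangle of a piece. -/
def openRect (P : Piece V) : Set (ℝ × ℝ) := P.map '' BoxLikeGIFS.unitSq

/-- The identity piece at `v`. -/
def one (v : V) : Piece V := ⟨1, 0, 1, 0, v⟩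

theorem map_one (v : V) : (one v).map = id := by
  funext z; simp [map, one]

/-- The piece `P ∘ ψ_e`. -/
def comp (S : BoxLikeGIFS V E) (P : Piece V) (e : E) : Piece V where
  u := P.u * (S.sa e * S.a e)
  tx := P.u * (S.trans e).1 + P.tx
  w := P.w * (S.sb e * S.b e)
  ty := P.w * (S.trans e).2 + P.ty
  vtx := S.term e

theorem map_comp {S : BoxLikeGIFS V E} (hdiag : ∀ e, S.diag e = true) (P : Piece V) (e : E)
    (z : ℝ × ℝ) : (P.comp S e).map z = P.map (S.map e z) := by
  simp only [map, comp, BoxLikeGIFS.map, hdiag, if_true, Prod.mk.injEq]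
  constructor <;> ring

theorem abs_u_comp (S : BoxLikeGIFS V E) (P : Piece V) (e : E) :
    |(P.comp S e).u| = |P.u| * S.a e := by
  have h := (S.a_mem e).1
  rcases S.sa_mem e with h1 | h1 <;> simp [comp, h1, abs_mul, abs_of_pos h]

theorem abs_w_comp (S : BoxLikeGIFS V E) (P : Piece V) (e : E) :
    |(P.comp S e).w| = |P.w| * S.b e := by
  have h := (S.b_mem e).1
  rcases S.sb_mem e with h1 | h1 <;> simp [comp, h1, abs_mul, abs_of_pos h]

theorem map_injective {P : Piece V} (hu : P.u ≠ 0) (hw : P.w ≠ 0) :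
    Function.Injective P.map := by
  intro z z' h
  simp only [map, Prod.mk.injEq, add_left_inj, mul_eq_mul_left_iff, hu, hw, or_false] at h
  exact Prod.ext h.1 h.2

theorem image_fst (P : Piece V) (Y : Set (ℝ × ℝ)) :
    Prod.fst '' (P.map '' Y) = (fun x => P.u * x + P.tx) '' (Prod.fst '' Y) := by
  simp only [Set.image_image, map]

theorem image_snd (P : Piece V) (Y : Set (ℝ × ℝ)) :
    Prod.snd '' (P.map '' Y) = (fun x => P.w * x + P.ty) '' (Prod.snd '' Y) := by
  simp only [Set.image_image, map]

end Piece

theorem exists_lattice_point {u t η x : ℝ} (hη : 0 < η) (hu : η ≤ |u|) (hx : x ∈ Icc (0 : ℝ) 1) :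
    ∃ k : ℤ, (∃ y ∈ Ioo (0 : ℝ) 1, u * y + t = k * (η / 4)) ∧
      |k * (η / 4) - (u * x + t)| ≤ η / 2 := by
  have hu0 : 0 < |u| := hη.trans_le hu
  have hune : u ≠ 0 := abs_pos.mp hu0
  set κ : ℝ := η / (4 * |u|) with hκ
  have hκ0 : 0 < κ := by positivity
  have hκ1 : κ ≤ 1 / 4 := by
    rw [hκ, div_le_iff₀ (by positivity)]; linarith
  have huκ : |u| * κ = η / 4 := by rw [hκ]; field_simp
  obtain ⟨x₀, hx₀, hx₀l, hx₀r⟩ : ∃ x₀, |x₀ - x| ≤ κ ∧ κ ≤ x₀ ∧ x₀ ≤ 1 - κ := by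
    by_cases h : x ≤ 1 / 2
    · exact ⟨x + κ, by simp [abs_of_pos hκ0], by linarith [hx.1], by linarith⟩
    · exact ⟨x - κ, by simp [abs_of_pos hκ0], by linarith, by linarith [hx.2]⟩
  set k : ℤ := round ((u * x₀ + t) / (η / 4)) with hk
  have hr : |k * (η / 4) - (u * x₀ + t)| ≤ η / 8 := by
    have h := abs_sub_round ((u * x₀ + t) / (η / 4))
    rw [← hk] at h
    have h2 : k * (η / 4) - (u * x₀ + t) = -(((u * x₀ + t) / (η / 4) - k) * (η / 4)) := by
      field_simp; ring
    rw [h2, abs_neg, abs_mul, abs_of_pos (by positivity : 0 < η / 4)]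
    calc _ ≤ 1 / 2 * (η / 4) := by gcongr
      _ = η / 8 := by ring
  refine ⟨k, ⟨(k * (η / 4) - t) / u, ?_, by field_simp; ring⟩, ?_⟩
  · have h3 : |(k * (η / 4) - t) / u - x₀| < κ := by
      have : (k * (η / 4) - t) / u - x₀ = (k * (η / 4) - (u * x₀ + t)) / u := by
        field_simp; ring
      rw [this, abs_div, div_lt_iff₀ hu0, mul_comm κ, huκ]
      linarith
    rw [abs_lt] at h3
    constructor <;> linarith [h3.1, h3.2]
  · have h4 : |u * x₀ - u * x| ≤ η / 4 := by
      rw [← mul_sub, abs_mul, ← huκ]; gcongr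
    have h5 : k * (η / 4) - (u * x + t) =
      (k * (η / 4) - (u * x₀ + t)) + (u * x₀ - u * x) := by ring
    rw [h5]
    exact (abs_add_le _ _).trans (by linarith)

/-- Bound for the number of lattice coordinates near a mesh interval. -/
def latticeBound (m : ℝ) : ℕ := ⌊4 / m⌋₊ + 6

theorem lattice_mem_Icc {m δ x : ℝ} {k l : ℤ} (hm : 0 < m) (hδ : 0 < δ)
    (hx : x ∈ meshCube1 δ l) (hk : |k * (m * δ / 4) - x| ≤ m * δ / 2) :
    k ∈ Finset.Icc (⌈l * (4 / m) - 2⌉) (⌈l * (4 / m) - 2⌉ + (latticeBound m - 1 : ℤ)) := by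
  rw [abs_le] at hk
  have hx1 := hx.1
  have hx2 := hx.2
  have e1 : (k : ℝ) * (m * δ / 4) = (k * (m / 4)) * δ := by ring
  have h1 : (l - m / 2) ≤ k * (m / 4) := by
    by_contra hcon
    push Not at hcon
    have := mul_lt_mul_of_pos_right hcon hδ
    nlinarith
  have h2 : k * (m / 4) ≤ l + 1 + m / 2 := by
    by_contra hcon
    push Not at hcon
    have := mul_lt_mul_of_pos_right hcon hδ
    nlinarith
  have h3 : l * (4 / m) - 2 ≤ k := by
    have : l * (4 / m) - 2 = (l - m / 2) * (4 / m) := by field_simp; ring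
    rw [this]
    calc _ ≤ k * (m / 4) * (4 / m) := by gcongr
      _ = k := by field_simp
  have h4 : (k : ℝ) ≤ l * (4 / m) + 4 / m + 2 := by
    have : l * (4 / m) + 4 / m + 2 = (l + 1 + m / 2) * (4 / m) := by field_simp; ring
    rw [this]
    calc (k : ℝ) = k * (m / 4) * (4 / m) := by field_simp
      _ ≤ _ := by gcongr
  rw [Finset.mem_Icc]
  refine ⟨Int.ceil_le.mpr h3, ?_⟩
  have h5 := Int.le_ceil (l * (4 / m) - 2)
  have h6 := (Nat.lt_floor_add_one (4 / m)).le
  have : (k : ℝ) ≤ ((⌈l * (4 / m) - 2⌉ + (latticeBound m - 1 : ℤ) : ℤ) : ℝ) := by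
    push_cast [latticeBound]; linarith
  exact_mod_cast this

theorem length_le_of_meets_cell {V : Type*} {m δ₁ δ₂ : ℝ} (hm : 0 < m) (h1 : 0 < δ₁)
    (h2 : 0 < δ₂) (L : List (Piece V))
    (hL : L.Pairwise fun Q Q' => Disjoint Q.openRect Q'.openRect)
    (hu : ∀ Q ∈ L, m * δ₁ ≤ |Q.u|) (hw : ∀ Q ∈ L, m * δ₂ ≤ |Q.w|) (l : ℤ × ℤ)
    (hz : ∀ Q ∈ L, ∃ z ∈ Icc (0 : ℝ) 1 ×ˢ Icc (0 : ℝ) 1,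
      Q.map z ∈ meshCube1 δ₁ l.1 ×ˢ meshCube1 δ₂ l.2) :
    L.length ≤ latticeBound m ^ 2 := by
  have key : ∀ Q : Piece V, ∃ k : ℤ × ℤ, Q ∈ L →
      ((k.1 * (m * δ₁ / 4), k.2 * (m * δ₂ / 4)) : ℝ × ℝ) ∈ Q.openRect ∧
      k.1 ∈ Finset.Icc (⌈l.1 * (4 / m) - 2⌉) (⌈l.1 * (4 / m) - 2⌉ + (latticeBound m - 1 : ℤ)) ∧
      k.2 ∈ Finset.Icc (⌈l.2 * (4 / m) - 2⌉) (⌈l.2 * (4 / m) - 2⌉ + (latticeBound m - 1 : ℤ)) := by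
    intro Q
    by_cases hQ : Q ∈ L
    · obtain ⟨z, ⟨hz1, hz2⟩, hzl1, hzl2⟩ := hz Q hQ
      obtain ⟨k₁, ⟨y₁, hy₁, e₁⟩, hk₁⟩ :=
        exists_lattice_point (t := Q.tx) (mul_pos hm h1) (hu Q hQ) hz1
      obtain ⟨k₂, ⟨y₂, hy₂, e₂⟩, hk₂⟩ :=
        exists_lattice_point (t := Q.ty) (mul_pos hm h2) (hw Q hQ) hz2
      refine ⟨(k₁, k₂), fun _ => ⟨⟨(y₁, y₂), ⟨hy₁, hy₂⟩, ?_⟩,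
        lattice_mem_Icc hm h1 hzl1 hk₁, lattice_mem_Icc hm h2 hzl2 hk₂⟩⟩
      simp only [Piece.map, e₁, e₂]
    · exact ⟨(0, 0), fun h => absurd h hQ⟩
  choose g hg using key
  have hnodup : (L.map g).Nodup := by
    rw [List.nodup_iff_pairwise_ne, List.pairwise_map]
    refine hL.imp_of_mem fun {Q Q'} hQ hQ' hdis heq => ?_
    have hQ1 := (hg Q hQ).1
    rw [heq] at hQ1
    exact Set.disjoint_left.mp hdis hQ1 (hg Q' hQ').1
  rw [← List.length_map g, ← List.toFinset_card_of_nodup hnodup]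
  have hsub : (L.map g).toFinset ⊆
      Finset.Icc (⌈l.1 * (4 / m) - 2⌉) (⌈l.1 * (4 / m) - 2⌉ + (latticeBound m - 1 : ℤ)) ×ˢ
      Finset.Icc (⌈l.2 * (4 / m) - 2⌉) (⌈l.2 * (4 / m) - 2⌉ + (latticeBound m - 1 : ℤ)) := by
    intro k hk
    rw [List.mem_toFinset, List.mem_map] at hk
    obtain ⟨Q, hQ, rfl⟩ := hk
    exact Finset.mem_product.mpr (hg Q hQ).2
  refine (Finset.card_le_card hsub).trans ?_
  rw [Finset.card_product, Int.card_Icc, Int.card_Icc, sq]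
  gcongr <;> omega

theorem sum_map_card_filter {α β : Type*} (L : List α) (K : Finset β) (r : α → β → Prop) :
    (L.map fun Q => (K.filter (r Q)).card).sum =
      ∑ l ∈ K, (L.filter fun Q => decide (r Q l)).length := by
  induction L with
  | nil => simp
  | cons Q L ih =>
    rw [List.map_cons, List.sum_cons, ih, Finset.card_filter, ← Finset.sum_add_distrib]
    refine Finset.sum_congr rfl fun l _ => ?_
    by_cases h : r Q l <;> simp [h, add_comm]

theorem sum_rectIdx_ncard_le {V : Type*} {m δ₁ δ₂ : ℝ} (hm : 0 < m) (h1 : 0 < δ₁)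
    (h2 : 0 < δ₂) (L : List (Piece V)) (X : V → Set (ℝ × ℝ)) (Y : Set (ℝ × ℝ))
    (hL : L.Pairwise fun Q Q' => Disjoint Q.openRect Q'.openRect)
    (hu : ∀ Q ∈ L, m * δ₁ ≤ |Q.u|) (hw : ∀ Q ∈ L, m * δ₂ ≤ |Q.w|)
    (hX : ∀ v, X v ⊆ Icc 0 1 ×ˢ Icc 0 1) (hY : Y ⊆ Icc 0 1 ×ˢ Icc 0 1)
    (hsub : ∀ Q ∈ L, Q.map '' X Q.vtx ⊆ Y) :
    (L.map fun Q => (rectIdx (Q.map '' X Q.vtx) δ₁ δ₂).ncard).sum ≤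
      (rectIdx Y δ₁ δ₂).ncard * latticeBound m ^ 2 := by
  have hfin := rectIdx_finite h1 h2 hY
  have hcongr : (L.map fun Q => (rectIdx (Q.map '' X Q.vtx) δ₁ δ₂).ncard) =
      L.map fun Q => (hfin.toFinset.filter
        (fun l => l ∈ rectIdx (Q.map '' X Q.vtx) δ₁ δ₂)).card := by
    refine List.map_congr_left fun Q hQ => ?_
    rw [← Set.ncard_coe_finset]
    congr 1
    ext l
    simp only [Finset.coe_filter, Set.Finite.mem_toFinset, Set.mem_ofPred_eq]
    exact ⟨fun h => ⟨rectIdx_mono (hsub Q hQ) _ _ h, h⟩, fun h => h.2⟩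
  rw [hcongr, sum_map_card_filter, Set.ncard_eq_toFinset_card _ hfin, ← smul_eq_mul]
  refine Finset.sum_le_card_nsmul _ _ _ fun l _ => ?_
  refine length_le_of_meets_cell hm h1 h2 _ (hL.filter _)
    (fun Q hQ => hu Q (List.mem_of_mem_filter hQ)) (fun Q hQ => hw Q (List.mem_of_mem_filter hQ))
    l fun Q hQ => ?_
  have := of_decide_eq_true (List.mem_filter.mp hQ).2
  obtain ⟨_, ⟨z, hz, rfl⟩, hl⟩ := this
  exact ⟨z, hX _ hz, hl⟩

namespace BoxLikeGIFS

variable {V E : Type*}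

/-! ### Weights of edges and pieces -/

/-- The edge weight `a_e^x b_e^y`. -/
def edgeWeight (S : BoxLikeGIFS V E) (x y : ℝ) (e : E) : ℝ := S.a e ^ x * S.b e ^ y

theorem edgeWeight_pos (S : BoxLikeGIFS V E) (x y : ℝ) (e : E) : 0 < S.edgeWeight x y e :=
  mul_pos (Real.rpow_pos_of_pos (S.a_mem e).1 _) (Real.rpow_pos_of_pos (S.b_mem e).1 _)

theorem exists_term_eq {S : BoxLikeGIFS V E} (hSC : S.StronglyConnected) (v : V) :
    ∃ e, S.term e = v := by
  cases hSC v v with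
  | single h => exact ⟨h.choose, h.choose_spec.2⟩
  | tail _ h => exact ⟨h.choose, h.choose_spec.2⟩

theorem comp_image_subset {S : BoxLikeGIFS V E} (hdiag : ∀ e, S.diag e = true) {X : V → Set (ℝ × ℝ)}
    (hX : S.IsGDAttractor X) {P : Piece V} {e : E} (he : S.init e = P.vtx) :
    (P.comp S e).map '' X (P.comp S e).vtx ⊆ P.map '' X P.vtx := by
  rintro _ ⟨z, hz, rfl⟩
  rw [Piece.map_comp hdiag]
  refine ⟨_, ?_, rfl⟩
  rw [hX.2 P.vtx]
  simp only [Set.mem_iUnion]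
  exact ⟨e, he, z, hz, rfl⟩

/-- The weight `|u|^x |w|^y` of a piece. -/
def pieceWeight (x y : ℝ) (P : Piece V) : ℝ := |P.u| ^ x * |P.w| ^ y

theorem pieceWeight_nonneg (x y : ℝ) (P : Piece V) : 0 ≤ pieceWeight x y P :=
  mul_nonneg (Real.rpow_nonneg (abs_nonneg _) _) (Real.rpow_nonneg (abs_nonneg _) _)

theorem pieceWeight_comp (S : BoxLikeGIFS V E) (x y : ℝ) (P : Piece V) (e : E) :
    pieceWeight x y (P.comp S e) = pieceWeight x y P * S.edgeWeight x y e := by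
  rw [pieceWeight, Piece.abs_u_comp, Piece.abs_w_comp,
    Real.mul_rpow (abs_nonneg _) (S.a_mem e).1.le, Real.mul_rpow (abs_nonneg _) (S.b_mem e).1.le,
    pieceWeight, edgeWeight]
  ring

variable [Fintype E]

/-! ### Path sums and the spectral radius -/

/-- The edges starting at `v`. -/
def edges (S : BoxLikeGIFS V E) (v : V) : Finset E := Finset.univ.filter fun e => S.init e = v

theorem mem_edges {S : BoxLikeGIFS V E} {v : V} {e : E} : e ∈ S.edges v ↔ S.init e = v := by
  simp [edges]

/-- Total weight `∑ g_{w_1} ⋯ g_{w_k}` of the paths of length `k` starting at `v`. -/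
def pathSum (S : BoxLikeGIFS V E) (g : E → ℝ) : ℕ → V → ℝ
  | 0, _ => 1
  | k + 1, v => ∑ e ∈ S.edges v, g e * pathSum S g k (S.term e)

theorem pathSum_pos (S : BoxLikeGIFS V E) {g : E → ℝ} (hg : ∀ e, 0 < g e) (k : ℕ) (v : V) :
    0 < S.pathSum g k v := by
  induction k generalizing v with
  | zero => exact one_pos
  | succ k ih =>
    obtain ⟨e, he⟩ := S.edge_exists v
    exact Finset.sum_pos (fun e _ => mul_pos (hg e) (ih _)) ⟨e, mem_edges.mpr he⟩

theorem pathSum_le_pow_mul (S : BoxLikeGIFS V E) {g g' : E → ℝ} {θ : ℝ} (hθ : 0 ≤ θ)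
    (hg : ∀ e, 0 < g e) (hg' : ∀ e, 0 < g' e) (h : ∀ e, g e ≤ θ * g' e) (k : ℕ) (v : V) :
    S.pathSum g k v ≤ θ ^ k * S.pathSum g' k v := by
  induction k generalizing v with
  | zero => simp [pathSum]
  | succ k ih =>
    rw [pathSum, pathSum, Finset.mul_sum]
    refine Finset.sum_le_sum fun e _ => ?_
    calc g e * S.pathSum g k (S.term e)
        ≤ (θ * g' e) * (θ ^ k * S.pathSum g' k (S.term e)) :=
          mul_le_mul (h e) (ih _) (S.pathSum_pos hg k _).le (mul_nonneg hθ (hg' e).le)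
      _ = _ := by ring

theorem pathSum_succ_le (S : BoxLikeGIFS V E) {g : E → ℝ} (hg : ∀ e, 0 < g e) (k : ℕ) (v : V) :
    S.pathSum g (k + 1) v ≤ (∑ e, g e) * S.pathSum g k v := by
  induction k generalizing v with
  | zero =>
    simp only [pathSum, mul_one]
    exact Finset.sum_le_sum_of_subset_of_nonneg (Finset.subset_univ _) fun e _ _ => (hg e).le
  | succ k ih =>
    rw [pathSum, pathSum, Finset.mul_sum]
    refine Finset.sum_le_sum fun e _ => ?_
    calc _ ≤ g e * ((∑ e, g e) * S.pathSum g k (S.term e)) := by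
          have := ih (S.term e)
          have := (hg e).le
          gcongr
      _ = _ := by ring

theorem pathSum_le_pow (S : BoxLikeGIFS V E) {g : E → ℝ} (hg : ∀ e, 0 < g e) (k : ℕ) (v : V) :
    S.pathSum g k v ≤ (∑ e, g e) ^ k := by
  induction k with
  | zero => simp [pathSum]
  | succ k ih =>
    refine (S.pathSum_succ_le hg k v).trans ?_
    rw [pow_succ']
    have : 0 ≤ ∑ e, g e := Finset.sum_nonneg fun e _ => (hg e).le
    gcongr

theorem pathSum_comparable [Finite V] {S : BoxLikeGIFS V E} (hSC : S.StronglyConnected)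
    {g : E → ℝ} (hg : ∀ e, 0 < g e) :
    ∃ C > 0, ∀ k v v', S.pathSum g k v' ≤ C * S.pathSum g k v := by
  have hedge : ∀ u u' : V, (∃ e, S.init e = u ∧ S.term e = u') →
      ∃ C > 0, ∀ k, S.pathSum g k u' ≤ C * S.pathSum g k u := by
    rintro _ _ ⟨e, rfl, rfl⟩
    have hG : 0 < ∑ e, g e := Finset.sum_pos (fun e _ => hg e) ⟨e, Finset.mem_univ e⟩
    refine ⟨(∑ e, g e) / g e, div_pos hG (hg e), fun k => ?_⟩
    have h1 : g e * S.pathSum g k (S.term e) ≤ S.pathSum g (k + 1) (S.init e) :=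
      Finset.single_le_sum (f := fun e => g e * S.pathSum g k (S.term e))
        (fun e _ => mul_nonneg (hg e).le (S.pathSum_pos hg k _).le) (mem_edges.mpr rfl)
    have h2 := h1.trans (S.pathSum_succ_le hg k (S.init e))
    rw [div_mul_eq_mul_div, le_div_iff₀ (hg e)]
    linarith
  have hpair : ∀ q : V × V, ∃ C > 0, ∀ k, S.pathSum g k q.2 ≤ C * S.pathSum g k q.1 := by
    rintro ⟨v, v'⟩
    induction hSC v v' with
    | single h => exact hedge _ _ h
    | tail _ h ih =>
      obtain ⟨C, hC, hC'⟩ := ih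
      obtain ⟨D, hD, hD'⟩ := hedge _ _ h
      refine ⟨D * C, mul_pos hD hC, fun k => (hD' k).trans ?_⟩
      rw [mul_assoc]
      exact mul_le_mul_of_nonneg_left (hC' k) hD.le
  choose C hC hC' using hpair
  have := Fintype.ofFinite V
  refine ⟨∑ q, C q + 1, by have := Finset.sum_nonneg fun q (_ : q ∈ Finset.univ) => (hC q).le
                           linarith, fun k v v' => (hC' (v, v') k).trans ?_⟩
  have h1 : C (v, v') ≤ ∑ q, C q :=
    Finset.single_le_sum (f := C) (fun q _ => (hC q).le) (Finset.mem_univ _)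
  exact mul_le_mul_of_nonneg_right (by linarith) (S.pathSum_pos hg k v).le

theorem Fmat_pow_nonneg (S : BoxLikeGIFS V E) (p : E → ℝ) (x y : ℝ) (k : ℕ) (e e' : E) :
    0 ≤ (S.Fmat p 0 x y ^ k) e e' := by
  induction k generalizing e' with
  | zero => rw [pow_zero, Matrix.one_apply]; split_ifs <;> norm_num
  | succ k ih =>
    rw [pow_succ, Matrix.mul_apply]
    refine Finset.sum_nonneg fun i _ => mul_nonneg (ih i) ?_
    have := (S.edgeWeight_pos x y e').le
    simp only [Fmat, FmatG]
    split_ifs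
    · simpa [edgeWeight] using this
    · exact le_rfl

theorem Fmat_pow_row_sum (S : BoxLikeGIFS V E) (p : E → ℝ) (x y : ℝ) (k : ℕ) (e : E) :
    ∑ e', (S.Fmat p 0 x y ^ k) e e' = S.pathSum (S.edgeWeight x y) k (S.term e) := by
  induction k generalizing e with
  | zero => simp [pathSum, Matrix.one_apply]
  | succ k ih =>
    simp only [pow_succ', Matrix.mul_apply]
    rw [Finset.sum_comm]
    simp only [← Finset.mul_sum, ih]
    rw [pathSum, edges, Finset.sum_filter]
    refine Finset.sum_congr rfl fun e' _ => ?_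
    simp only [Fmat, FmatG, edgeWeight, eq_comm (a := S.term e), Real.rpow_zero, one_mul]
    split_ifs <;> simp

theorem mnorm_Fmat_pow (S : BoxLikeGIFS V E) (p : E → ℝ) (x y : ℝ) (k : ℕ) :
    mnorm (S.Fmat p 0 x y ^ k) = ∑ e, S.pathSum (S.edgeWeight x y) k (S.term e) := by
  unfold mnorm
  refine Finset.sum_congr rfl fun e _ => ?_
  rw [← S.Fmat_pow_row_sum p]
  exact Finset.sum_congr rfl fun e' _ => abs_of_nonneg (S.Fmat_pow_nonneg p x y k e e')

theorem mnorm_Fmat_pow_nonneg (S : BoxLikeGIFS V E) (p : E → ℝ) (x y : ℝ) (k : ℕ) :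
    0 ≤ mnorm (S.Fmat p 0 x y ^ k) := by
  rw [mnorm_Fmat_pow]
  exact Finset.sum_nonneg fun e _ => (S.pathSum_pos (S.edgeWeight_pos x y) k _).le

theorem isBoundedUnder_mnorm (S : BoxLikeGIFS V E) (p : E → ℝ) (x y : ℝ) :
    IsBoundedUnder (· ≤ ·) atTop
      fun k : ℕ => (mnorm (S.Fmat p 0 x y ^ k)) ^ ((k : ℝ)⁻¹) := by
  set G : ℝ := ∑ e, S.edgeWeight x y e with hG
  have hG0 : 0 ≤ G := Finset.sum_nonneg fun e _ => (S.edgeWeight_pos x y e).le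
  refine isBoundedUnder_of_eventually_le (a := Fintype.card E * G) ?_
  filter_upwards [eventually_ge_atTop 1] with k hk
  have hk0 : k ≠ 0 := by omega
  have h1 : mnorm (S.Fmat p 0 x y ^ k) ≤ (Fintype.card E * G) ^ k := by
    rw [mnorm_Fmat_pow, mul_pow]
    calc _ ≤ ∑ _e : E, G ^ k :=
          Finset.sum_le_sum fun e _ => S.pathSum_le_pow (S.edgeWeight_pos x y) k _
      _ = Fintype.card E * G ^ k := by simp
      _ ≤ _ := by
        have h2 : (Fintype.card E : ℝ) ≤ (Fintype.card E : ℝ) ^ k := by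
          exact_mod_cast Nat.le_self_pow hk0 _
        gcongr
  calc _ ≤ ((Fintype.card E * G) ^ k) ^ ((k : ℝ)⁻¹) :=
        Real.rpow_le_rpow (S.mnorm_Fmat_pow_nonneg p x y k) h1 (by positivity)
    _ = _ := Real.pow_rpow_inv_natCast (by positivity) hk0

theorem eventually_pathSum_le {S : BoxLikeGIFS V E} (hSC : S.StronglyConnected) {p : E → ℝ}
    {x y θ : ℝ} (hF : specRad (S.Fmat p 0 x y) = 1) (hθ : 1 < θ) :
    ∀ᶠ k in atTop, ∀ v, S.pathSum (S.edgeWeight x y) k v ≤ θ ^ k := by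
  have h := eventually_lt_of_limsup_lt (hF.trans_lt hθ) (S.isBoundedUnder_mnorm p x y)
  filter_upwards [h, eventually_ge_atTop 1] with k hk hk1 v
  have hk0 : k ≠ 0 := by omega
  obtain ⟨e, rfl⟩ := exists_term_eq hSC v
  have h1 : S.pathSum (S.edgeWeight x y) k (S.term e) ≤ mnorm (S.Fmat p 0 x y ^ k) := by
    rw [mnorm_Fmat_pow]
    exact Finset.single_le_sum (f := fun e => S.pathSum (S.edgeWeight x y) k (S.term e))
      (fun e _ => (S.pathSum_pos (S.edgeWeight_pos x y) k _).le) (Finset.mem_univ e)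
  refine h1.trans ?_
  have h2 := pow_le_pow_left₀ (Real.rpow_nonneg (S.mnorm_Fmat_pow_nonneg p x y k) _) hk.le k
  rwa [Real.rpow_inv_natCast_pow (S.mnorm_Fmat_pow_nonneg p x y k) hk0] at h2

theorem frequently_lt_mnorm {S : BoxLikeGIFS V E} {p : E → ℝ} {x y θ : ℝ}
    (hF : specRad (S.Fmat p 0 x y) = 1) (hθ0 : 0 < θ) (hθ : θ < 1) :
    ∃ᶠ k in atTop, θ ^ k < mnorm (S.Fmat p 0 x y ^ k) := by
  have hcob : IsCoboundedUnder (· ≤ ·) atTop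
      fun k : ℕ => (mnorm (S.Fmat p 0 x y ^ k)) ^ ((k : ℝ)⁻¹) := by
    refine IsBoundedUnder.isCoboundedUnder_le ?_
    exact isBoundedUnder_of_eventually_ge (a := 0)
      (Eventually.of_forall fun k => Real.rpow_nonneg (S.mnorm_Fmat_pow_nonneg p x y k) _)
  have h := frequently_lt_of_lt_limsup hcob (hθ.trans_eq hF.symm)
  refine (h.and_eventually (eventually_ge_atTop 1)).mono fun k ⟨hk, hk1⟩ => ?_
  have hk0 : k ≠ 0 := by omega
  have h2 := pow_lt_pow_left₀ hk hθ0.le hk0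
  rwa [Real.rpow_inv_natCast_pow (S.mnorm_Fmat_pow_nonneg p x y k) hk0] at h2

theorem exists_sum_pathSum_le [Finite V] {S : BoxLikeGIFS V E} (hSC : S.StronglyConnected)
    {p : E → ℝ} {x y θ : ℝ} {g : E → ℝ} (hF : specRad (S.Fmat p 0 x y) = 1) (hθ0 : 0 < θ)
    (hθ : θ < 1) (hg0 : ∀ e, 0 < g e) (hg : ∀ e, g e ≤ θ * S.edgeWeight x y e) :
    ∃ C > 0, ∀ n v, ∑ k ∈ Finset.range n, S.pathSum g k v ≤ C := by
  have hθ1 : 1 < (2 - θ) := by linarith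
  have hq : θ * (2 - θ) < 1 := by nlinarith
  have hq0 : 0 ≤ θ * (2 - θ) := by nlinarith
  obtain ⟨K, hK⟩ := eventually_atTop.mp (eventually_pathSum_le hSC hF hθ1)
  have hgeo : Summable fun k : ℕ => (θ * (2 - θ)) ^ k := summable_geometric_of_lt_one hq0 hq
  have hsum : ∀ v, Summable fun k => S.pathSum g k v := by
    intro v
    rw [← summable_nat_add_iff K]
    refine Summable.of_nonneg_of_le (fun k => (S.pathSum_pos hg0 _ v).le) (fun k => ?_)
      ((summable_nat_add_iff K).mpr hgeo)
    calc _ ≤ θ ^ (k + K) * S.pathSum (S.edgeWeight x y) (k + K) v :=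
          S.pathSum_le_pow_mul hθ0.le hg0 (S.edgeWeight_pos x y) hg _ _
      _ ≤ θ ^ (k + K) * (2 - θ) ^ (k + K) := by
          have := hK (k + K) (by omega) v
          gcongr
      _ = _ := by rw [mul_pow]
  have := Fintype.ofFinite V
  have hnn : ∀ v, 0 ≤ ∑' k, S.pathSum g k v := fun v =>
    tsum_nonneg fun k => (S.pathSum_pos hg0 k v).le
  refine ⟨∑ v, (∑' k, S.pathSum g k v) + 1, ?_, fun n v => ?_⟩
  · have := Finset.sum_nonneg fun v (_ : v ∈ Finset.univ) => hnn v
    linarith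
  · have h1 := (hsum v).sum_le_tsum (Finset.range n) fun k _ => (S.pathSum_pos hg0 k v).le
    have h2 : ∑' k, S.pathSum g k v ≤ ∑ v, ∑' k, S.pathSum g k v :=
      Finset.single_le_sum (f := fun v => ∑' k, S.pathSum g k v) (fun v _ => hnn v)
        (Finset.mem_univ v)
    linarith

theorem exists_subinvariant [Finite V] {S : BoxLikeGIFS V E} (hSC : S.StronglyConnected)
    {p : E → ℝ} {x y θ : ℝ} {g : E → ℝ} (hF : specRad (S.Fmat p 0 x y) = 1) (hθ0 : 0 < θ)
    (hθ : θ < 1) (hg0 : ∀ e, 0 < g e) (hg : ∀ e, S.edgeWeight x y e ≤ θ * g e) :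
    ∃ (h : V → ℝ) (H : ℝ), (∀ v, 1 ≤ h v) ∧ (∀ v, h v ≤ H) ∧
      ∀ v, h v ≤ ∑ e ∈ S.edges v, g e * h (S.term e) := by
  obtain ⟨C, hC, hcomp⟩ := pathSum_comparable hSC (S.edgeWeight_pos x y)
  obtain ⟨θ₁, h01, h11⟩ := exists_between hθ
  have hθ₁ : 0 < θ₁ := hθ0.trans h01
  have hfreq := frequently_lt_mnorm hF hθ₁ h11
  have htend : Tendsto (fun k : ℕ => (θ₁ / θ) ^ k) atTop atTop :=
    tendsto_pow_atTop_atTop_of_one_lt ((one_lt_div hθ0).mpr h01)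
  obtain ⟨k, hk, hk1, hk2⟩ := (hfreq.and_eventually ((eventually_ge_atTop 1).and
    (htend.eventually_ge_atTop (Fintype.card E * C)))).exists
  obtain ⟨K, rfl⟩ : ∃ K, k = K + 1 := ⟨k - 1, by omega⟩
  have hone : ∀ v, 1 ≤ S.pathSum g (K + 1) v := by
    intro v
    have h1 : mnorm (S.Fmat p 0 x y ^ (K + 1)) ≤
        Fintype.card E * C * (θ ^ (K + 1) * S.pathSum g (K + 1) v) := by
      rw [mnorm_Fmat_pow]
      calc _ ≤ ∑ _e : E, C * S.pathSum (S.edgeWeight x y) (K + 1) v :=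
            Finset.sum_le_sum fun e _ => hcomp _ _ _
        _ = Fintype.card E * C * S.pathSum (S.edgeWeight x y) (K + 1) v := by
            simp [mul_assoc]
        _ ≤ _ := by
            have := S.pathSum_le_pow_mul hθ0.le (S.edgeWeight_pos x y) hg0 hg (K + 1) v
            gcongr
    have h2 : θ₁ ^ (K + 1) ≤ θ₁ ^ (K + 1) * S.pathSum g (K + 1) v := by
      refine (hk.le.trans h1).trans ?_
      rw [← mul_assoc]
      refine mul_le_mul_of_nonneg_right ?_ (S.pathSum_pos hg0 _ v).le
      rw [div_pow, le_div_iff₀ (by positivity)] at hk2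
      exact hk2
    exact le_of_mul_le_mul_left (by simpa using h2) (pow_pos hθ₁ (K + 1))
  have := Fintype.ofFinite V
  refine ⟨fun v => ∑ k ∈ Finset.range (K + 1), S.pathSum g k v,
    ∑ v, ∑ k ∈ Finset.range (K + 1), S.pathSum g k v, fun v => ?_, fun v => ?_, fun v => ?_⟩
  · exact Finset.single_le_sum (f := fun k => S.pathSum g k v)
      (fun k _ => (S.pathSum_pos hg0 k v).le) (Finset.mem_range.mpr (Nat.succ_pos K))
  · exact Finset.single_le_sum (f := fun v => ∑ k ∈ Finset.range (K + 1), S.pathSum g k v)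
      (fun v _ => Finset.sum_nonneg fun k _ => (S.pathSum_pos hg0 k v).le) (Finset.mem_univ v)
  · simp only [Finset.mul_sum]
    rw [Finset.sum_comm]
    have h3 : ∑ k ∈ Finset.range (K + 1), ∑ e ∈ S.edges v, g e * S.pathSum g k (S.term e) =
        ∑ k ∈ Finset.range (K + 1), S.pathSum g (k + 1) v := rfl
    have h4 : S.pathSum g 0 v = 1 := rfl
    rw [h3]
    linarith [hone v, Finset.sum_range_succ (fun k => S.pathSum g k v) (K + 1),
      Finset.sum_range_succ' (fun k => S.pathSum g k v) (K + 1)]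

/-! ### Cut sets of pieces -/

/-- Subdivide the piece `P` at most `n` times, stopping as soon as the shorter side is
less than `δ`. -/
def cut (S : BoxLikeGIFS V E) : ℕ → ℝ → Piece V → List (Piece V)
  | 0, _, P => [P]
  | n + 1, δ, P => if min |P.u| |P.w| < δ then [P] else
      (S.edges P.vtx).toList.flatMap fun e => cut S n δ (P.comp S e)

theorem sum_map_flatMap {α β : Type*} (l : Finset α) (f : α → List β) (φ : β → ℝ) :
    ((l.toList.flatMap f).map φ).sum = ∑ a ∈ l, ((f a).map φ).sum := by
  rw [← Finset.sum_map_toList]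
  induction l.toList with
  | nil => simp
  | cons a l ih => simp [ih]

variable {S : BoxLikeGIFS V E}

theorem cut_abs_pos {n : ℕ} {δ : ℝ} {P Q : Piece V} (hu : 0 < |P.u|) (hw : 0 < |P.w|)
    (hQ : Q ∈ S.cut n δ P) : (0 < |Q.u| ∧ |Q.u| ≤ |P.u|) ∧ (0 < |Q.w| ∧ |Q.w| ≤ |P.w|) := by
  induction n generalizing P with
  | zero => simp only [cut, List.mem_singleton] at hQ; subst hQ; exact ⟨⟨hu, le_rfl⟩, hw, le_rfl⟩
  | succ n ih =>
    rw [cut] at hQ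
    split_ifs at hQ
    · simp only [List.mem_singleton] at hQ; subst hQ; exact ⟨⟨hu, le_rfl⟩, hw, le_rfl⟩
    · rw [List.mem_flatMap] at hQ
      obtain ⟨e, _, he⟩ := hQ
      have hu' := S.a_mem e
      have hw' := S.b_mem e
      have h := ih (P := P.comp S e) (by rw [Piece.abs_u_comp]; exact mul_pos hu hu'.1)
        (by rw [Piece.abs_w_comp]; exact mul_pos hw hw'.1) he
      rw [Piece.abs_u_comp, Piece.abs_w_comp] at h
      exact ⟨⟨h.1.1, h.1.2.trans (mul_le_of_le_one_right hu.le hu'.2.le)⟩,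
        h.2.1, h.2.2.trans (mul_le_of_le_one_right hw.le hw'.2.le)⟩

theorem cut_sides {m r : ℝ} (hm : 0 < m) (hr : ∀ e, m ≤ S.a e ∧ S.a e ≤ r ∧ m ≤ S.b e ∧ S.b e ≤ r)
    {n : ℕ} {δ : ℝ} {P Q : Piece V} (hP : m * δ ≤ min |P.u| |P.w|)
    (hn : min |P.u| |P.w| * r ^ n < δ) (hQ : Q ∈ S.cut n δ P) :
    m * δ ≤ min |Q.u| |Q.w| ∧ min |Q.u| |Q.w| < δ := by
  induction n generalizing P with
  | zero =>
    simp only [cut, List.mem_singleton] at hQ; subst hQ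
    exact ⟨hP, by simpa using hn⟩
  | succ n ih =>
    rw [cut] at hQ
    split_ifs at hQ with hlt
    · simp only [List.mem_singleton] at hQ; subst hQ
      exact ⟨hP, hlt⟩
    · rw [List.mem_flatMap] at hQ
      obtain ⟨e, _, he⟩ := hQ
      obtain ⟨ha1, ha2, hb1, hb2⟩ := hr e
      have hr0 : 0 < r := hm.trans_le (ha1.trans ha2)
      have hu0 : 0 ≤ |P.u| := abs_nonneg _
      have hw0 : 0 ≤ |P.w| := abs_nonneg _
      push Not at hlt
      refine ih (P := P.comp S e) ?_ ?_ he
      · rw [Piece.abs_u_comp, Piece.abs_w_comp]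
        refine le_min ?_ ?_
        · rw [mul_comm m]
          exact mul_le_mul (hlt.trans (min_le_left _ _)) ha1 hm.le hu0
        · rw [mul_comm m]
          exact mul_le_mul (hlt.trans (min_le_right _ _)) hb1 hm.le hw0
      · refine lt_of_le_of_lt ?_ hn
        rw [Piece.abs_u_comp, Piece.abs_w_comp, pow_succ', ← mul_assoc]
        refine mul_le_mul_of_nonneg_right ?_ (by positivity)
        rw [min_mul_of_nonneg _ _ hr0.le]
        exact min_le_min (by gcongr) (by gcongr)

theorem cut_openRect (hdiag : ∀ e, S.diag e = true) (hROSC : S.ROSC) {n : ℕ} {δ : ℝ}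
    {P : Piece V} (hu : 0 < |P.u|) (hw : 0 < |P.w|) :
    (∀ Q ∈ S.cut n δ P, Q.openRect ⊆ P.openRect) ∧
      (S.cut n δ P).Pairwise fun Q Q' => Disjoint Q.openRect Q'.openRect := by
  induction n generalizing P with
  | zero => simp [cut]
  | succ n ih =>
    rw [cut]
    split_ifs
    · simp
    have hcomp : ∀ e, (P.comp S e).openRect = P.map '' (S.map e '' unitSq) := by
      intro e
      rw [Piece.openRect, Set.image_image]
      exact Set.image_congr fun z _ => Piece.map_comp hdiag P e z
    have hu' : ∀ e, 0 < |(P.comp S e).u| := fun e => by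
      rw [Piece.abs_u_comp]; exact mul_pos hu (S.a_mem e).1
    have hw' : ∀ e, 0 < |(P.comp S e).w| := fun e => by
      rw [Piece.abs_w_comp]; exact mul_pos hw (S.b_mem e).1
    refine ⟨fun Q hQ => ?_, ?_⟩
    · rw [List.mem_flatMap] at hQ
      obtain ⟨e, _, he⟩ := hQ
      refine ((ih (hu' e) (hw' e)).1 Q he).trans ?_
      rw [hcomp]
      exact Set.image_mono (hROSC.1 e)
    · rw [List.pairwise_flatMap]
      refine ⟨fun e _ => (ih (hu' e) (hw' e)).2, ?_⟩
      refine (Finset.nodup_toList _).pairwise_of_forall_ne fun e he e' he' hne Q hQ Q' hQ' => ?_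
      rw [Finset.mem_toList, mem_edges] at he he'
      refine Disjoint.mono ((ih (hu' e) (hw' e)).1 Q hQ) ((ih (hu' e') (hw' e')).1 Q' hQ') ?_
      rw [hcomp, hcomp]
      exact Set.disjoint_image_of_injective
        (Piece.map_injective (abs_pos.mp hu) (abs_pos.mp hw)) (hROSC.2 e e' hne (he.trans he'.symm))

theorem cut_image_subset (hdiag : ∀ e, S.diag e = true) {X : V → Set (ℝ × ℝ)}
    (hX : S.IsGDAttractor X) {n : ℕ} {δ : ℝ} {P Q : Piece V} (hQ : Q ∈ S.cut n δ P) :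
    Q.map '' X Q.vtx ⊆ P.map '' X P.vtx := by
  induction n generalizing P with
  | zero => simp only [cut, List.mem_singleton] at hQ; subst hQ; rfl
  | succ n ih =>
    rw [cut] at hQ
    split_ifs at hQ
    · simp only [List.mem_singleton] at hQ; subst hQ; rfl
    · rw [List.mem_flatMap] at hQ
      obtain ⟨e, he0, he⟩ := hQ
      exact (ih he).trans (comp_image_subset hdiag hX (by simpa [mem_edges] using he0))

theorem exists_mem_cut (hdiag : ∀ e, S.diag e = true) {X : V → Set (ℝ × ℝ)}
    (hX : S.IsGDAttractor X) {n : ℕ} {δ : ℝ} {P : Piece V} {z : ℝ × ℝ}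
    (hz : z ∈ P.map '' X P.vtx) : ∃ Q ∈ S.cut n δ P, z ∈ Q.map '' X Q.vtx := by
  induction n generalizing P with
  | zero => exact ⟨P, by simp [cut], hz⟩
  | succ n ih =>
    rw [cut]
    split_ifs
    · exact ⟨P, by simp, hz⟩
    · obtain ⟨y, hy, rfl⟩ := hz
      rw [hX.2 P.vtx] at hy
      simp only [Set.mem_iUnion] at hy
      obtain ⟨e, he, x, hx, rfl⟩ := hy
      obtain ⟨Q, hQ, hzQ⟩ := ih (P := P.comp S e)
        ⟨x, hx, Piece.map_comp hdiag P e x⟩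
      exact ⟨Q, List.mem_flatMap.mpr ⟨e, by simpa [mem_edges] using he, hQ⟩, hzQ⟩

theorem le_sum_cut {x y : ℝ} {h : V → ℝ}
    (hsub : ∀ v, h v ≤ ∑ e ∈ S.edges v, S.edgeWeight x y e * h (S.term e))
    (n : ℕ) (δ : ℝ) (P : Piece V) : pieceWeight x y P * h P.vtx ≤
      ((S.cut n δ P).map fun Q => pieceWeight x y Q * h Q.vtx).sum := by
  induction n generalizing P with
  | zero => simp [cut]
  | succ n ih =>
    rw [cut]
    split_ifs
    · simp
    · rw [sum_map_flatMap]
      calc _ ≤ pieceWeight x y P * ∑ e ∈ S.edges P.vtx, S.edgeWeight x y e * h (S.term e) :=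
            mul_le_mul_of_nonneg_left (hsub _) (pieceWeight_nonneg x y P)
        _ = ∑ e ∈ S.edges P.vtx, pieceWeight x y (P.comp S e) * h (P.comp S e).vtx := by
            rw [Finset.mul_sum]
            refine Finset.sum_congr rfl fun e _ => ?_
            rw [pieceWeight_comp, mul_assoc]; rfl
        _ ≤ _ := Finset.sum_le_sum fun e _ => ih _

theorem sum_cut_le (x y : ℝ) (n : ℕ) (δ : ℝ) (P : Piece V) :
    ((S.cut n δ P).map (pieceWeight x y)).sum ≤ pieceWeight x y P *
      ∑ k ∈ Finset.range (n + 1), S.pathSum (S.edgeWeight x y) k P.vtx := by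
  induction n generalizing P with
  | zero => simp [cut, pathSum]
  | succ n ih =>
    rw [cut, Finset.sum_range_succ', mul_add]
    have hnn : 0 ≤ pieceWeight x y P * ∑ k ∈ Finset.range (n + 1),
        S.pathSum (S.edgeWeight x y) (k + 1) P.vtx :=
      mul_nonneg (pieceWeight_nonneg x y P) (Finset.sum_nonneg fun k _ =>
        (S.pathSum_pos (S.edgeWeight_pos x y) _ _).le)
    split_ifs
    · simpa [pathSum] using hnn
    · rw [sum_map_flatMap]
      calc _ ≤ ∑ e ∈ S.edges P.vtx, pieceWeight x y P * (S.edgeWeight x y e *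
              ∑ k ∈ Finset.range (n + 1), S.pathSum (S.edgeWeight x y) k (S.term e)) := by
            refine Finset.sum_le_sum fun e _ => (ih _).trans (le_of_eq ?_)
            rw [pieceWeight_comp, mul_assoc]; rfl
        _ = pieceWeight x y P * ∑ k ∈ Finset.range (n + 1),
              S.pathSum (S.edgeWeight x y) (k + 1) P.vtx := by
            rw [← Finset.mul_sum]
            congr 1
            simp only [Finset.mul_sum]
            rw [Finset.sum_comm]
            rfl
        _ ≤ _ := le_add_of_nonneg_right (by simpa [pathSum] using pieceWeight_nonneg x y P)

theorem sum_cut_zero (x y : ℝ) (n : ℕ) (P : Piece V) :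
    ((S.cut n 0 P).map (pieceWeight x y)).sum =
      pieceWeight x y P * S.pathSum (S.edgeWeight x y) n P.vtx := by
  induction n generalizing P with
  | zero => simp [cut, pathSum]
  | succ n ih =>
    have hlt : ¬ min |P.u| |P.w| < 0 := not_lt.mpr (le_min (abs_nonneg _) (abs_nonneg _))
    rw [cut, if_neg hlt, sum_map_flatMap, pathSum, Finset.mul_sum]
    refine Finset.sum_congr rfl fun e _ => ?_
    rw [ih, pieceWeight_comp, mul_assoc]; rfl

end BoxLikeGIFS

namespace BoxLikeGIFS

variable {V E : Type*}

/-! ### Attractor and measures: support properties -/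

theorem exists_ratio_bounds [Finite E] [Nonempty V] (S : BoxLikeGIFS V E) :
    ∃ m r : ℝ, 0 < m ∧ r < 1 ∧ m ≤ r ∧ ∀ e, m ≤ S.a e ∧ S.a e ≤ r ∧ m ≤ S.b e ∧ S.b e ≤ r := by
  have : Nonempty E := ⟨(S.edge_exists (Classical.arbitrary V)).choose⟩
  obtain ⟨e₀, h₀⟩ := Finite.exists_min fun e => min (S.a e) (S.b e)
  obtain ⟨e₁, h₁⟩ := Finite.exists_max fun e => max (S.a e) (S.b e)
  have hb : ∀ e, min (S.a e₀) (S.b e₀) ≤ S.a e ∧ S.a e ≤ max (S.a e₁) (S.b e₁) ∧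
      min (S.a e₀) (S.b e₀) ≤ S.b e ∧ S.b e ≤ max (S.a e₁) (S.b e₁) := fun e =>
    ⟨(h₀ e).trans (min_le_left _ _), (le_max_left _ _).trans (h₁ e),
      (h₀ e).trans (min_le_right _ _), (le_max_right _ _).trans (h₁ e)⟩
  exact ⟨_, _, lt_min (S.a_mem e₀).1 (S.b_mem e₀).1, max_lt (S.a_mem e₁).2 (S.b_mem e₁).2,
    (hb e₀).1.trans (hb e₀).2.1, hb⟩

variable {S : BoxLikeGIFS V E}

theorem continuous_map (hdiag : ∀ e, S.diag e = true) (e : E) : Continuous (S.map e) := by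
  have : S.map e = fun z => (S.sa e * S.a e * z.1 + (S.trans e).1,
      S.sb e * S.b e * z.2 + (S.trans e).2) := by
    funext z; simp [map, hdiag]
  rw [this]
  fun_prop

theorem dist_map_le (hdiag : ∀ e, S.diag e = true) {r : ℝ}
    (hr : ∀ e, S.a e ≤ r ∧ S.b e ≤ r) (e : E) (z z' : ℝ × ℝ) :
    dist (S.map e z) (S.map e z') ≤ r * dist z z' := by
  have hsa : |S.sa e| = 1 := by rcases S.sa_mem e with h | h <;> simp [h]
  have hsb : |S.sb e| = 1 := by rcases S.sb_mem e with h | h <;> simp [h]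
  have hr0 : 0 ≤ r := (S.a_mem e).1.le.trans (hr e).1
  simp only [map, hdiag, if_true, Prod.dist_eq, Real.dist_eq, add_sub_add_right_eq_sub,
    ← mul_sub, abs_mul, hsa, hsb, abs_of_pos (S.a_mem e).1, abs_of_pos (S.b_mem e).1, one_mul]
  refine max_le ?_ ?_
  · exact mul_le_mul (hr e).1 (le_max_left _ _) (abs_nonneg _) hr0
  · exact mul_le_mul (hr e).2 (le_max_right _ _) (abs_nonneg _) hr0

theorem infDist_map_le (hdiag : ∀ e, S.diag e = true) {r : ℝ} (hr0 : 0 < r)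
    (hr : ∀ e, S.a e ≤ r ∧ S.b e ≤ r) (e : E) {A B : Set (ℝ × ℝ)} (hA : A.Nonempty)
    (hAB : S.map e '' A ⊆ B) (z : ℝ × ℝ) :
    Metric.infDist (S.map e z) B ≤ r * Metric.infDist z A := by
  rw [← div_le_iff₀' hr0, Metric.le_infDist hA]
  intro y hy
  rw [div_le_iff₀' hr0]
  exact (Metric.infDist_le_dist_of_mem (hAB ⟨y, hy, rfl⟩)).trans (dist_map_le hdiag hr e z y)

theorem map_closedSq_subset (hdiag : ∀ e, S.diag e = true) (hROSC : S.ROSC) (e : E) :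
    S.map e '' (Icc 0 1 ×ˢ Icc 0 1) ⊆ Icc 0 1 ×ˢ Icc 0 1 := by
  have hcl : closure unitSq = Icc (0 : ℝ) 1 ×ˢ Icc (0 : ℝ) 1 := by
    rw [unitSq, closure_prod_eq, closure_Ioo (by norm_num)]
  rw [← hcl]
  exact (image_closure_subset_closure_image (continuous_map hdiag e)).trans
    (closure_mono (hROSC.1 e))

theorem attractor_subset [Finite V] (hdiag : ∀ e, S.diag e = true) (hROSC : S.ROSC) {r : ℝ}
    (hr0 : 0 < r) (hr1 : r < 1) (hr : ∀ e, S.a e ≤ r ∧ S.b e ≤ r) {X : V → Set (ℝ × ℝ)}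
    (hX : S.IsGDAttractor X) (v : V) : X v ⊆ Icc 0 1 ×ˢ Icc 0 1 := by
  set K : Set (ℝ × ℝ) := Icc (0 : ℝ) 1 ×ˢ Icc (0 : ℝ) 1 with hK
  have hKne : K.Nonempty := ⟨(0, 0), by simp [hK]⟩
  have hKcl : IsClosed K := isClosed_Icc.prod isClosed_Icc
  have hbd : ∃ C, ∀ v, ∀ z ∈ X v, Metric.infDist z K ≤ C := by
    have h : ∀ v, ∃ C, ∀ z ∈ X v, ‖Metric.infDist z K‖ ≤ C := fun v =>
      (hX.1 v).2.exists_bound_of_continuousOn (Metric.continuous_infDist_pt K).continuousOn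
    choose C hC using h
    obtain ⟨D, hD⟩ := (Set.finite_range C).bddAbove
    exact ⟨D, fun v z hz => ((le_abs_self _).trans (hC v z hz)).trans (hD ⟨v, rfl⟩)⟩
  obtain ⟨C, hC⟩ := hbd
  have hn : ∀ n : ℕ, ∀ v, ∀ z ∈ X v, Metric.infDist z K ≤ r ^ n * C := by
    intro n
    induction n with
    | zero => simpa using hC
    | succ n ih =>
      intro v z hz
      rw [hX.2 v] at hz
      simp only [Set.mem_iUnion] at hz
      obtain ⟨e, he, y, hy, rfl⟩ := hz
      calc _ ≤ r * Metric.infDist y K :=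
            infDist_map_le hdiag hr0 hr e hKne (map_closedSq_subset hdiag hROSC e) y
        _ ≤ r * (r ^ n * C) := by have := ih _ y hy; gcongr
        _ = _ := by ring
  intro z hz
  rw [hKcl.mem_iff_infDist_zero hKne]
  refine le_antisymm ?_ Metric.infDist_nonneg
  have ht : Tendsto (fun n : ℕ => r ^ n * C) atTop (nhds (0 * C)) :=
    (tendsto_pow_atTop_nhds_zero_of_lt_one hr0.le hr1).mul_const C
  rw [zero_mul] at ht
  exact ge_of_tendsto' ht fun n => hn n v z hz

theorem attractor_map_subset {X : V → Set (ℝ × ℝ)} (hX : S.IsGDAttractor X) (e : E) :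
    S.map e '' X (S.term e) ⊆ X (S.init e) := by
  intro z hz
  rw [hX.2 (S.init e)]
  simp only [Set.mem_iUnion]
  exact ⟨e, rfl, hz⟩

variable [Fintype E]

theorem measure_apply (hdiag : ∀ e, S.diag e = true) {p : E → ℝ} {μ : V → Measure (ℝ × ℝ)}
    (hμ : S.IsGDMeasure p μ) (v : V) {s : Set (ℝ × ℝ)} (hs : MeasurableSet s) :
    μ v s = ∑ e ∈ S.edges v, ENNReal.ofReal (p e) * μ (S.term e) (S.map e ⁻¹' s) := by
  have h := congrArg (fun ν : Measure (ℝ × ℝ) => ν s) (hμ.2 v)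
  change μ v s = _ at h
  rw [h, Measure.finsetSum_apply, edges, Finset.sum_filter]
  refine Finset.sum_congr rfl fun e _ => ?_
  split_ifs
  · rw [Measure.smul_apply, Measure.map_apply (continuous_map hdiag e).measurable hs,
      smul_eq_mul]
  · simp

theorem sum_weights {p : E → ℝ} (hp : S.IsWeights p) (v : V) :
    ∑ e ∈ S.edges v, ENNReal.ofReal (p e) = 1 := by
  rw [← ENNReal.ofReal_sum_of_nonneg fun e _ => (hp.1 e).le, edges, Finset.sum_filter, hp.2 v,
    ENNReal.ofReal_one]

theorem measure_compl_attractor [Finite V] (hdiag : ∀ e, S.diag e = true) {r : ℝ}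
    (hr0 : 0 < r) (hr1 : r < 1) (hr : ∀ e, S.a e ≤ r ∧ S.b e ≤ r) {X : V → Set (ℝ × ℝ)}
    (hX : S.IsGDAttractor X) {p : E → ℝ} (hp : S.IsWeights p) {μ : V → Measure (ℝ × ℝ)}
    (hμ : S.IsGDMeasure p μ) (v : V) : μ v (X v)ᶜ = 0 := by
  have := Fintype.ofFinite V
  have hprob := hμ.1
  set T : V → ℝ → Set (ℝ × ℝ) := fun v ρ => {z | ρ < Metric.infDist z (X v)} with hT
  have hTm : ∀ v ρ, MeasurableSet (T v ρ) := fun v ρ =>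
    (isOpen_lt continuous_const (Metric.continuous_infDist_pt (X v))).measurableSet
  have hstep : ∀ n : ℕ, ∀ ρ v, μ v (T v ρ) ≤ ∑ v', μ v' (T v' (ρ / r ^ n)) := by
    intro n
    induction n with
    | zero =>
      intro ρ v
      simp only [pow_zero, div_one]
      exact Finset.single_le_sum (f := fun v' => μ v' (T v' ρ)) (fun _ _ => zero_le)
        (Finset.mem_univ v)
    | succ n ih =>
      intro ρ v
      rw [measure_apply hdiag hμ v (hTm v ρ)]
      calc _ ≤ ∑ e ∈ S.edges v, ENNReal.ofReal (p e) *
              ∑ v', μ v' (T v' (ρ / r ^ (n + 1))) := by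
            refine Finset.sum_le_sum fun e he => ?_
            gcongr
            have h1 := ih (ρ / r) (S.term e)
            rw [div_div, ← pow_succ'] at h1
            refine le_trans (measure_mono fun z hz => ?_) h1
            have h2 := infDist_map_le hdiag hr0 hr e (hX.1 (S.term e)).1
              (attractor_map_subset hX e) z
            rw [mem_edges.mp he] at h2
            change ρ / r < _
            rw [div_lt_iff₀' hr0]
            exact lt_of_lt_of_le hz h2
        _ = _ := by rw [← Finset.sum_mul, sum_weights hp, one_mul]
  have hlim : ∀ ρ > 0, ∀ v', Tendsto (fun n : ℕ => μ v' (T v' (ρ / r ^ n))) atTop (nhds 0) := by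
    intro ρ hρ v'
    have hmono : Antitone fun n : ℕ => T v' (ρ / r ^ n) := by
      intro n k hnk z hz
      change ρ / r ^ k < Metric.infDist z (X v') at hz
      change ρ / r ^ n < Metric.infDist z (X v')
      refine lt_of_le_of_lt ?_ hz
      have := pow_le_pow_of_le_one hr0.le hr1.le hnk
      gcongr
    have h := tendsto_measure_iInter_atTop (μ := μ v')
      (fun n => (hTm v' (ρ / r ^ n)).nullMeasurableSet) hmono ⟨0, measure_ne_top _ _⟩
    have hempty : ⋂ n : ℕ, T v' (ρ / r ^ n) = ∅ := by
      rw [Set.eq_empty_iff_forall_notMem]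
      intro z hz
      rw [Set.mem_iInter] at hz
      have ht : Tendsto (fun n : ℕ => r ^ n * Metric.infDist z (X v')) atTop (nhds 0) := by
        simpa using (tendsto_pow_atTop_nhds_zero_of_lt_one hr0.le hr1).mul_const
          (Metric.infDist z (X v'))
      have h0 : ρ ≤ 0 := ge_of_tendsto' ht fun n => by
        have := hz n
        change ρ / r ^ n < _ at this
        rw [div_lt_iff₀' (by positivity)] at this
        exact this.le
      linarith
    rwa [hempty, measure_empty] at h
  have hzero : ∀ ρ > 0, μ v (T v ρ) = 0 := by
    intro ρ hρ
    refine le_antisymm ?_ zero_le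
    have h := tendsto_finsetSum Finset.univ fun v' _ => hlim ρ hρ v'
    rw [Finset.sum_const_zero] at h
    exact ge_of_tendsto' h fun n => hstep n ρ v
  have hcover : (X v)ᶜ ⊆ ⋃ n : ℕ, T v (1 / ((n : ℝ) + 1)) := by
    intro z hz
    have hpos : 0 < Metric.infDist z (X v) :=
      ((hX.1 v).2.isClosed.notMem_iff_infDist_pos (hX.1 v).1).mp hz
    obtain ⟨n, hn⟩ := exists_nat_one_div_lt hpos
    exact Set.mem_iUnion.mpr ⟨n, hn⟩
  refine measure_mono_null hcover (measure_iUnion_null fun n => hzero _ (by positivity))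

theorem measure_ball_pos [Finite V] (hdiag : ∀ e, S.diag e = true) (hROSC : S.ROSC) {r : ℝ}
    (hr0 : 0 < r) (hr1 : r < 1) (hr : ∀ e, S.a e ≤ r ∧ S.b e ≤ r) {X : V → Set (ℝ × ℝ)}
    (hX : S.IsGDAttractor X) {p : E → ℝ} (hp : S.IsWeights p) {μ : V → Measure (ℝ × ℝ)}
    (hμ : S.IsGDMeasure p μ) (v : V) {z : ℝ × ℝ} (hz : z ∈ X v) {ρ : ℝ} (hρ : 0 < ρ) :
    0 < μ v (Metric.ball z ρ) := by
  have hprob := hμ.1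
  have key : ∀ n : ℕ, ∀ v, ∀ z ∈ X v, ∀ ρ, 2 * r ^ n ≤ ρ → 0 < μ v (Metric.ball z ρ) := by
    intro n
    induction n with
    | zero =>
      intro v z hz ρ hρ
      have hsub : X v ⊆ Metric.ball z ρ := by
        intro y hy
        have h1 := attractor_subset hdiag hROSC hr0 hr1 hr hX v hz
        have h2 := attractor_subset hdiag hROSC hr0 hr1 hr hX v hy
        rw [Metric.mem_ball]
        refine lt_of_le_of_lt (b := 1) ?_ (by simp at hρ; linarith)
        rw [Prod.dist_eq, Real.dist_eq, Real.dist_eq]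
        refine max_le (abs_le.mpr ⟨?_, ?_⟩) (abs_le.mpr ⟨?_, ?_⟩) <;>
          linarith [h1.1.1, h1.1.2, h1.2.1, h1.2.2, h2.1.1, h2.1.2, h2.2.1, h2.2.2]
      refine lt_of_lt_of_le ?_ (measure_mono hsub)
      rw [prob_compl_eq_zero_iff (hX.1 v).2.measurableSet |>.mp
        (measure_compl_attractor hdiag hr0 hr1 hr hX hp hμ v)]
      exact one_pos
    | succ n ih =>
      intro v z hz ρ hρ
      rw [hX.2 v] at hz
      simp only [Set.mem_iUnion] at hz
      obtain ⟨e, he, y, hy, rfl⟩ := hz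
      rw [measure_apply hdiag hμ v Metric.isOpen_ball.measurableSet]
      refine lt_of_lt_of_le ?_ (Finset.single_le_sum (fun _ _ => zero_le) (mem_edges.mpr he))
      refine ENNReal.mul_pos (ENNReal.ofReal_pos.mpr (hp.1 e)).ne' (ne_of_gt ?_)
      refine lt_of_lt_of_le (ih _ y hy (ρ / r) ?_) (measure_mono fun x hx => ?_)
      · rw [le_div_iff₀ hr0]; linarith [pow_succ r n]
      · rw [Metric.mem_ball, lt_div_iff₀' hr0] at hx
        exact lt_of_le_of_lt (dist_map_le hdiag hr e x y) hx
  have ht : Tendsto (fun n : ℕ => 2 * r ^ n) atTop (nhds 0) := by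
    simpa using (tendsto_pow_atTop_nhds_zero_of_lt_one hr0.le hr1).const_mul 2
  obtain ⟨n, hn⟩ := (ht.eventually_lt_const hρ).exists
  exact key n v z hz ρ hn.le

end BoxLikeGIFS

/-! ### From the moment sum at `q = 0` to mesh counts -/

theorem Dq1_zero_eq_natCast {ν : Measure ℝ} {Y : Set ℝ} {δ : ℝ} (hδ : 0 < δ)
    (hY : Y ⊆ Icc 0 1) (hnull : ν Yᶜ = 0)
    (hpos : ∀ x ∈ Y, ∀ ρ > 0, 0 < ν (Metric.ball x ρ)) :
    ∃ D : ℕ, Dq1 ν δ 0 = D ∧ D ≤ (meshIdx Y δ).ncard ∧ (meshIdx Y δ).ncard ≤ D * 3 := by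
  set A : Set ℤ := {k | ν (meshCube1 δ k) ≠ 0} with hA
  have hsub : A ⊆ meshIdx Y δ := by
    intro k hk
    by_contra hcon
    refine hk (measure_mono_null (fun x hx => ?_) hnull)
    exact fun hxY => hcon ⟨x, hxY, hx⟩
  have hfin := meshIdx_finite hδ hY
  have hAfin : A.Finite := hfin.subset hsub
  refine ⟨A.ncard, ?_, Set.ncard_le_ncard hsub hfin, ?_⟩
  · rw [Dq1, tsum_eq_sum (s := hAfin.toFinset)]
    · rw [Set.ncard_eq_toFinset_card _ hAfin, Finset.card_eq_sum_ones, Nat.cast_sum]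
      refine Finset.sum_congr rfl fun k hk => ?_
      have : ν (meshCube1 δ k) ≠ 0 := by simpa [hA] using hk
      simp [this]
    · intro k hk
      have : ν (meshCube1 δ k) = 0 := by simpa [hA] using hk
      simp [this]
  · refine ncard_le_ncard_mul (fun k => Icc (k - 1) (k + 1)) 3 hAfin
      (fun k _ => Set.finite_Icc _ _) (fun k _ => ?_) ?_
    · rw [← Finset.coe_Icc, Set.ncard_coe_finset, Int.card_Icc]; omega
    · rintro k ⟨x, hxY, hx1, hx2⟩
      have hball : Metric.ball x δ ⊆
          meshCube1 δ (k - 1) ∪ meshCube1 δ k ∪ meshCube1 δ (k + 1) := by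
        intro y hy
        rw [Metric.mem_ball, Real.dist_eq, abs_lt] at hy
        simp only [meshCube1, Set.mem_union, Set.mem_Icc] at *
        push_cast
        by_cases h1 : y ≤ k * δ
        · left; left; constructor <;> linarith
        · by_cases h2 : y ≤ (k + 1) * δ
          · left; right; constructor <;> linarith
          · right; constructor <;> linarith
      have hp := hpos x hxY δ hδ
      by_contra hcon
      push Not at hcon
      have hz : ∀ j : ℤ, k ∈ Icc (j - 1) (j + 1) → ν (meshCube1 δ j) = 0 := by
        intro j hj
        by_contra hne
        exact hcon j hne hj
      refine hp.ne' (measure_mono_null hball ?_)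
      rw [measure_union_null_iff, measure_union_null_iff]
      refine ⟨⟨hz _ ?_, hz _ ?_⟩, hz _ ?_⟩ <;> constructor <;> omega

/-- Two-sided power bounds, up to arbitrarily small changes of the exponent, for the mesh counts
of the sets `Y v`, uniformly in `v` and in bounded scales. -/
def MeshExponent {V : Type*} (Y : V → Set ℝ) (τ : ℝ) : Prop :=
  ∀ ε > 0, ∀ R ≥ 1, ∃ C > 0, ∀ v, ∀ δ, 0 < δ → δ ≤ R →
    ((meshIdx (Y v) δ).ncard : ℝ) ≤ C * δ ^ (-(τ + ε)) ∧
    δ ^ (-(τ - ε)) ≤ C * ((meshIdx (Y v) δ).ncard : ℝ)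

theorem le_rpow_neg_of_log_le {N δ s : ℝ} (hN : 0 < N) (hδ : 0 < δ)
    (h : Real.log N ≤ s * (-Real.log δ)) : N ≤ δ ^ (-s) := by
  rw [Real.rpow_def_of_pos hδ, ← Real.log_le_iff_le_exp hN]
  linarith

theorem rpow_neg_le_of_le_log {N δ s : ℝ} (hN : 0 < N) (hδ : 0 < δ)
    (h : s * (-Real.log δ) ≤ Real.log N) : δ ^ (-s) ≤ N := by
  rw [Real.rpow_def_of_pos hδ, ← Real.le_log_iff_exp_le hN]
  linarith

theorem meshExponent_of_hasLq1 {V : Type*} [Finite V] [Nonempty V] {ν : V → Measure ℝ}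
    {Y : V → Set ℝ} {τ : ℝ} (hτ : ∀ v, HasLq1 (ν v) 0 τ) (hne : ∀ v, (Y v).Nonempty)
    (hY : ∀ v, Y v ⊆ Icc 0 1) (hnull : ∀ v, ν v (Y v)ᶜ = 0)
    (hpos : ∀ v, ∀ x ∈ Y v, ∀ ρ > 0, 0 < ν v (Metric.ball x ρ)) :
    0 ≤ τ ∧ MeshExponent Y τ := by
  have hcount : ∀ v, ∀ δ > 0, ∃ D : ℕ, Dq1 (ν v) δ 0 = D ∧ 0 < D ∧
      D ≤ (meshIdx (Y v) δ).ncard ∧ (meshIdx (Y v) δ).ncard ≤ D * 3 ∧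
      0 < (meshIdx (Y v) δ).ncard := by
    intro v δ hδ
    obtain ⟨D, h1, h2, h3⟩ := Dq1_zero_eq_natCast hδ (hY v) (hnull v) (hpos v)
    have : 0 < (meshIdx (Y v) δ).ncard := by
      rw [Set.ncard_pos (meshIdx_finite hδ (hY v))]
      obtain ⟨x, hx⟩ := hne v
      obtain ⟨k, hk⟩ := exists_mem_meshCube1 hδ x
      exact ⟨k, x, hx, hk⟩
    exact ⟨D, h1, by omega, h2, h3, this⟩
  have hlt : ∀ᶠ δ : ℝ in nhdsWithin 0 (Ioi 0), 0 < δ ∧ δ < 1 := by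
    filter_upwards [Ioo_mem_nhdsGT (zero_lt_one' ℝ)] with δ hδ using hδ
  have hτ0 : 0 ≤ τ := by
    refine ge_of_tendsto (hτ (Classical.arbitrary V)) ?_
    filter_upwards [hlt] with δ ⟨hδ, hδ1⟩
    obtain ⟨D, h1, h2, -⟩ := hcount (Classical.arbitrary V) δ hδ
    rw [h1]
    exact div_nonneg (Real.log_natCast_nonneg D) (by linarith [Real.log_neg hδ hδ1])
  refine ⟨hτ0, fun ε hε R hR => ?_⟩
  have hev : ∀ᶠ δ : ℝ in nhdsWithin 0 (Ioi 0), (0 < δ ∧ δ < 1) ∧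
      ∀ v, Real.log (Dq1 (ν v) δ 0) / (-Real.log δ) ∈ Ioo (τ - ε) (τ + ε) := by
    refine hlt.and (eventually_all.mpr fun v => ?_)
    exact (hτ v).eventually (Ioo_mem_nhds (by linarith) (by linarith))
  obtain ⟨δ₀, hδ₀, hsub⟩ := mem_nhdsGT_iff_exists_Ioo_subset.mp hev
  have hδ₀' : 0 < δ₀ := hδ₀
  have hR0 : 0 < R := by linarith
  have hp1 : 0 < R ^ (τ + ε) := Real.rpow_pos_of_pos hR0 _
  have hp2 : 0 < δ₀ ^ (-τ) * R ^ ε :=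
    mul_pos (Real.rpow_pos_of_pos hδ₀' _) (Real.rpow_pos_of_pos hR0 _)
  have hp3 : 0 < (1 / δ₀ + 3) * R ^ (τ + ε) := by positivity
  refine ⟨3 + (1 / δ₀ + 3) * R ^ (τ + ε) + δ₀ ^ (-τ) * R ^ ε, by positivity,
    fun v δ hδ hδR => ?_⟩
  obtain ⟨D, h1, h2, h3, h4, h5⟩ := hcount v δ hδ
  have h3' : (D : ℝ) ≤ (meshIdx (Y v) δ).ncard := by exact_mod_cast h3
  have h4' : ((meshIdx (Y v) δ).ncard : ℝ) ≤ D * 3 := by exact_mod_cast h4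
  have h5' : (1 : ℝ) ≤ (meshIdx (Y v) δ).ncard := by exact_mod_cast h5
  have hD : (0 : ℝ) < D := by exact_mod_cast h2
  have hx1 : 0 < δ ^ (-(τ + ε)) := Real.rpow_pos_of_pos hδ _
  by_cases hcase : δ < δ₀
  · obtain ⟨⟨-, hδ1⟩, hv⟩ := hsub ⟨hδ, hcase⟩
    have hl : 0 < -Real.log δ := by linarith [Real.log_neg hδ hδ1]
    obtain ⟨hv1, hv2⟩ := hv v
    rw [h1] at hv1 hv2
    rw [lt_div_iff₀ hl] at hv1
    rw [div_lt_iff₀ hl] at hv2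
    have hu := le_rpow_neg_of_log_le hD hδ hv2.le
    have hlw := rpow_neg_le_of_le_log hD hδ hv1.le
    constructor
    · nlinarith
    · nlinarith
  · push Not at hcase
    constructor
    · have hN := meshIdx_ncard_le hδ zero_le_one (hY v)
      have hN' : (1 - 0) / δ + 3 ≤ 1 / δ₀ + 3 := by rw [sub_zero]; gcongr
      have hone : 1 ≤ R ^ (τ + ε) * δ ^ (-(τ + ε)) := by
        rw [Real.rpow_neg hδ.le, ← div_eq_mul_inv, one_le_div (Real.rpow_pos_of_pos hδ _)]
        exact Real.rpow_le_rpow hδ.le hδR (by linarith)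
      have hq : 0 < 1 / δ₀ + 3 := by positivity
      calc ((meshIdx (Y v) δ).ncard : ℝ) ≤ (1 / δ₀ + 3) * 1 := by linarith
        _ ≤ (1 / δ₀ + 3) * (R ^ (τ + ε) * δ ^ (-(τ + ε))) := by gcongr
        _ = ((1 / δ₀ + 3) * R ^ (τ + ε)) * δ ^ (-(τ + ε)) := by ring
        _ ≤ _ := by gcongr; linarith
    · have h6 : δ ^ (-(τ - ε)) ≤ δ₀ ^ (-τ) * R ^ ε := by
        rw [neg_sub, sub_eq_neg_add, Real.rpow_add hδ]
        exact mul_le_mul (Real.rpow_le_rpow_of_nonpos hδ₀' hcase (by linarith))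
          (Real.rpow_le_rpow hδ.le hδR hε.le) (Real.rpow_nonneg hδ.le _)
          (Real.rpow_nonneg hδ₀'.le _)
      nlinarith

/-! ### Elementary estimates -/

theorem rpow_le_of_comparable {m a b : ℝ} (hm : 0 < m) (ha : 0 < a) (hb : 0 < b)
    (hab : m * a ≤ b) (hba : m * b ≤ a) (y : ℝ) : a ^ y ≤ m ^ (-|y|) * b ^ y := by
  rcases le_total 0 y with hy | hy
  · rw [abs_of_nonneg hy, Real.rpow_neg hm.le, ← Real.inv_rpow hm.le,
      ← Real.mul_rpow (inv_nonneg.mpr hm.le) hb.le]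
    refine Real.rpow_le_rpow ha.le ?_ hy
    rwa [inv_mul_eq_div, le_div_iff₀' hm]
  · rw [abs_of_nonpos hy, neg_neg, ← Real.mul_rpow hm.le hb.le]
    exact Real.rpow_le_rpow_of_nonpos (by positivity) hba hy

theorem div_rpow_neg_le {m u w δ : ℝ} (hm : 0 < m) (hu : 0 < u) (hδ : 0 < δ)
    (hw : m * δ ≤ w) (hwδ : w ≤ δ) (x y : ℝ) :
    (δ / u) ^ (-x) ≤ m ^ (-|y|) * (δ ^ (-(x + y)) * (u ^ x * w ^ y)) := by
  have hw0 : 0 < w := lt_of_lt_of_le (by positivity) hw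
  have h := rpow_le_of_comparable hm hδ hw0 hw (by nlinarith) y
  have h1 : (δ / u) ^ (-x) = u ^ x * (δ ^ (-(x + y)) * δ ^ y) := by
    rw [← Real.rpow_add hδ, Real.div_rpow hδ.le hu.le, Real.rpow_neg hu.le, div_inv_eq_mul,
      mul_comm]
    congr 2; ring
  have h2 : 0 < u ^ x * δ ^ (-(x + y)) :=
    mul_pos (Real.rpow_pos_of_pos hu _) (Real.rpow_pos_of_pos hδ _)
  rw [h1]
  nlinarith [mul_le_mul_of_nonneg_left h h2.le]

theorem le_div_rpow_neg {m u w δ : ℝ} (hm : 0 < m) (hu : 0 < u) (hδ : 0 < δ)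
    (hw : m * δ ≤ w) (hwδ : w ≤ δ) (hwu : w ≤ u) {x τ : ℝ} (hx : x ≤ τ) (y : ℝ) :
    δ ^ (-(x + y)) * (u ^ x * w ^ y) ≤ m ^ (-|y| + (x - τ)) * (δ / u) ^ (-τ) := by
  have hw0 : 0 < w := lt_of_lt_of_le (by positivity) hw
  have h := rpow_le_of_comparable hm hw0 hδ (by nlinarith) hw y
  have h1 : (δ / u) ^ (-x) = u ^ x * (δ ^ (-(x + y)) * δ ^ y) := by
    rw [← Real.rpow_add hδ, Real.div_rpow hδ.le hu.le, Real.rpow_neg hu.le, div_inv_eq_mul,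
      mul_comm]
    congr 2; ring
  have h2 : 0 < u ^ x * δ ^ (-(x + y)) :=
    mul_pos (Real.rpow_pos_of_pos hu _) (Real.rpow_pos_of_pos hδ _)
  have h3 : (δ / u) ^ (-x) ≤ m ^ (x - τ) * (δ / u) ^ (-τ) := by
    have h4 : (δ / u) ^ (-x) = (δ / u) ^ (τ - x) * (δ / u) ^ (-τ) := by
      rw [← Real.rpow_add (by positivity)]; congr 1; ring
    rw [h4]
    refine mul_le_mul_of_nonneg_right ?_ (Real.rpow_nonneg (by positivity) _)
    rw [← neg_sub τ x, Real.rpow_neg hm.le, ← Real.inv_rpow hm.le]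
    refine Real.rpow_le_rpow (by positivity) ?_ (by linarith)
    rw [div_le_iff₀ hu, inv_mul_eq_div, le_div_iff₀' hm]
    exact hw.trans hwu
  have h5 : 0 < m ^ (-|y|) := Real.rpow_pos_of_pos hm _
  rw [Real.rpow_add hm]
  calc δ ^ (-(x + y)) * (u ^ x * w ^ y) = u ^ x * δ ^ (-(x + y)) * w ^ y := by ring
    _ ≤ u ^ x * δ ^ (-(x + y)) * (m ^ (-|y|) * δ ^ y) := by gcongr
    _ = m ^ (-|y|) * (δ / u) ^ (-x) := by rw [h1]; ring
    _ ≤ m ^ (-|y|) * (m ^ (x - τ) * (δ / u) ^ (-τ)) := by gcongr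
    _ = _ := by ring

theorem ncard_le_sum_map {α ι : Type*} (L : List α) (f : α → Set ι)
    (hf : ∀ Q ∈ L, (f Q).Finite) {A : Set ι} (hA : ∀ k ∈ A, ∃ Q ∈ L, k ∈ f Q) :
    A.ncard ≤ (L.map fun Q => (f Q).ncard).sum := by
  induction L generalizing A with
  | nil =>
    have : A = ∅ := Set.eq_empty_iff_forall_notMem.mpr fun k hk => by simpa using hA k hk
    simp [this]
  | cons Q L ih =>
    rw [List.map_cons, List.sum_cons]
    have h1 := ih (fun Q' hQ' => hf Q' (List.mem_cons_of_mem _ hQ')) (A := A \ f Q) fun k hk => by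
      obtain ⟨Q', hQ', hk'⟩ := hA k hk.1
      rcases List.mem_cons.mp hQ' with rfl | h
      · exact absurd hk' hk.2
      · exact ⟨Q', h, hk'⟩
    have h2 := Set.ncard_le_ncard_sdiff_add_ncard A (f Q) (hf Q List.mem_cons_self)
    omega

theorem sum_map_eq_sum_filter {α ι : Type*} [DecidableEq ι] (L : List α) (φ : α → ℝ) (c : α → ι)
    (s : Finset ι) (hs : ∀ Q ∈ L, c Q ∈ s) :
    (L.map φ).sum = ∑ i ∈ s, ((L.filter fun Q => decide (c Q = i)).map φ).sum := by
  induction L with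
  | nil => simp
  | cons Q L ih =>
    rw [List.map_cons, List.sum_cons, ih fun Q' hQ' => hs Q' (List.mem_cons_of_mem _ hQ')]
    have h : ∀ i, (((Q :: L).filter fun Q => decide (c Q = i)).map φ).sum =
        (if c Q = i then φ Q else 0) + ((L.filter fun Q => decide (c Q = i)).map φ).sum := by
      intro i
      by_cases hi : c Q = i <;> simp [hi]
    simp only [h, Finset.sum_add_distrib, Finset.sum_ite_eq, hs Q List.mem_cons_self, if_true]

theorem tendsto_log_div_of_rpow_bounds {N : ℝ → ℝ} {s : ℝ}
    (hlow : ∀ ε > 0, ∃ C > 0, ∀ δ, 0 < δ → δ < 1 → δ ^ (-(s - ε)) ≤ C * N δ)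
    (hupp : ∀ ε > 0, ∃ C > 0, ∀ δ, 0 < δ → δ < 1 → N δ ≤ C * δ ^ (-(s + ε))) :
    Tendsto (fun δ => Real.log (N δ) / (-Real.log δ)) (nhdsWithin 0 (Ioi 0)) (nhds s) := by
  have hlt : ∀ᶠ δ : ℝ in nhdsWithin 0 (Ioi 0), 0 < δ ∧ δ < 1 := by
    filter_upwards [Ioo_mem_nhdsGT (zero_lt_one' ℝ)] with δ hδ using hδ
  have hinf : Tendsto (fun δ : ℝ => -Real.log δ) (nhdsWithin 0 (Ioi 0)) atTop :=
    tendsto_neg_atBot_atTop.comp Real.tendsto_log_nhdsGT_zero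
  rw [Metric.tendsto_nhds]
  intro ε hε
  obtain ⟨C, hC, hl⟩ := hlow (ε / 2) (by positivity)
  obtain ⟨D, hD, hu⟩ := hupp (ε / 2) (by positivity)
  filter_upwards [hlt, hinf.eventually_gt_atTop (Real.log C / (ε / 2)),
    hinf.eventually_gt_atTop (Real.log D / (ε / 2))] with δ hδ h1 h2
  have hlog : 0 < -Real.log δ := by linarith [Real.log_neg hδ.1 hδ.2]
  have hl' := hl δ hδ.1 hδ.2
  have hu' := hu δ hδ.1 hδ.2
  have hN : 0 < N δ := by
    have := lt_of_lt_of_le (Real.rpow_pos_of_pos hδ.1 (-(s - ε / 2))) hl'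
    exact (pos_iff_pos_of_mul_pos this).mp hC
  have hl2 := Real.log_le_log (Real.rpow_pos_of_pos hδ.1 _) hl'
  have hu2 := Real.log_le_log hN hu'
  rw [Real.log_rpow hδ.1, Real.log_mul hC.ne' hN.ne'] at hl2
  rw [Real.log_mul hD.ne' (Real.rpow_pos_of_pos hδ.1 _).ne', Real.log_rpow hδ.1] at hu2
  rw [div_lt_iff₀ (by positivity)] at h1 h2
  rw [Real.dist_eq, abs_lt]
  constructor
  · rw [lt_sub_iff_add_lt, lt_div_iff₀ hlog]; nlinarith
  · rw [sub_lt_iff_lt_add, div_lt_iff₀ hlog]; nlinarith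

/-! ### Mesh counts of pieces -/

section pieces

variable {V : Type*} {Q : Piece V} {Y : Set (ℝ × ℝ)} {δ : ℝ}

theorem affine_image_subset_Icc {Y : Set ℝ} (hY : Y ⊆ Icc 0 1) {w δ : ℝ} (t : ℝ) (hw : |w| ≤ δ) :
    (fun x => w * x + t) '' Y ⊆ Icc (t + min w 0) (t + min w 0 + δ) := by
  rintro _ ⟨x, hx, rfl⟩
  obtain ⟨h0, h1⟩ := hY hx
  rcases le_total 0 w with h | h
  · rw [abs_of_nonneg h] at hw
    rw [min_eq_right h]
    constructor <;> nlinarith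
  · rw [abs_of_nonpos h] at hw
    rw [min_eq_left h]
    constructor <;> nlinarith

theorem fst_image_subset (hY : Y ⊆ Icc 0 1 ×ˢ Icc 0 1) : Prod.fst '' Y ⊆ Icc 0 1 := by
  rintro _ ⟨z, hz, rfl⟩; exact (hY hz).1

theorem snd_image_subset (hY : Y ⊆ Icc 0 1 ×ˢ Icc 0 1) : Prod.snd '' Y ⊆ Icc 0 1 := by
  rintro _ ⟨z, hz, rfl⟩; exact (hY hz).2

theorem rectIdx_piece_le_fst (hδ : 0 < δ) (hY : Y ⊆ Icc 0 1 ×ˢ Icc 0 1)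
    (hQY : Q.map '' Y ⊆ Icc 0 1 ×ˢ Icc 0 1) (hu : 0 < |Q.u|) (hw : |Q.w| ≤ δ) :
    (rectIdx (Q.map '' Y) δ δ).ncard ≤ (meshIdx (Prod.fst '' Y) (δ / |Q.u|)).ncard * 9 := by
  have h := rectIdx_ncard_le_mul hδ hδ hQY
  rw [Q.image_fst, Q.image_snd] at h
  have h1 := meshIdx_image_ncard_le Q.tx hδ (abs_pos.mp hu) (fst_image_subset hY)
  have h2 := meshIdx_ncard_le_three hδ (affine_image_subset_Icc (snd_image_subset hY) Q.ty hw)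
  calc _ ≤ _ := h
    _ ≤ (meshIdx (Prod.fst '' Y) (δ / |Q.u|)).ncard * 3 * 3 := Nat.mul_le_mul h1 h2
    _ = _ := by ring

theorem rectIdx_piece_le_snd (hδ : 0 < δ) (hY : Y ⊆ Icc 0 1 ×ˢ Icc 0 1)
    (hQY : Q.map '' Y ⊆ Icc 0 1 ×ˢ Icc 0 1) (hw : 0 < |Q.w|) (hu : |Q.u| ≤ δ) :
    (rectIdx (Q.map '' Y) δ δ).ncard ≤ (meshIdx (Prod.snd '' Y) (δ / |Q.w|)).ncard * 9 := by
  have h := rectIdx_ncard_le_mul hδ hδ hQY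
  rw [Q.image_fst, Q.image_snd] at h
  have h1 := meshIdx_image_ncard_le Q.ty hδ (abs_pos.mp hw) (snd_image_subset hY)
  have h2 := meshIdx_ncard_le_three hδ (affine_image_subset_Icc (fst_image_subset hY) Q.tx hu)
  calc _ ≤ _ := h
    _ ≤ 3 * ((meshIdx (Prod.snd '' Y) (δ / |Q.w|)).ncard * 3) := Nat.mul_le_mul h2 h1
    _ = _ := by ring

theorem meshIdx_fst_le_rectIdx_piece (hδ : 0 < δ) (hQY : Q.map '' Y ⊆ Icc 0 1 ×ˢ Icc 0 1)
    (hu : 0 < |Q.u|) :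
    (meshIdx (Prod.fst '' Y) (δ / |Q.u|)).ncard ≤ (rectIdx (Q.map '' Y) δ δ).ncard * 3 := by
  have h := meshIdx_fst_ncard_le hδ hδ hQY
  have h0 := fst_image_subset hQY
  rw [Q.image_fst] at h h0
  exact (meshIdx_ncard_le_image Q.tx hδ (abs_pos.mp hu) h0).trans (Nat.mul_le_mul_right 3 h)

theorem meshIdx_snd_le_rectIdx_piece (hδ : 0 < δ) (hQY : Q.map '' Y ⊆ Icc 0 1 ×ˢ Icc 0 1)
    (hw : 0 < |Q.w|) :
    (meshIdx (Prod.snd '' Y) (δ / |Q.w|)).ncard ≤ (rectIdx (Q.map '' Y) δ δ).ncard * 3 := by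
  have h := meshIdx_snd_ncard_le hδ hδ hQY
  have h0 := snd_image_subset hQY
  rw [Q.image_snd] at h h0
  exact (meshIdx_ncard_le_image Q.ty hδ (abs_pos.mp hw) h0).trans (Nat.mul_le_mul_right 3 h)

end pieces

namespace BoxLikeGIFS

variable {V E : Type*} {S : BoxLikeGIFS V E} {X : V → Set (ℝ × ℝ)} {τA τB : ℝ}

/-! ### Bounds for the path sums -/

theorem edgeWeight_add_le {m r : ℝ} (hm : 0 < m)
    (hr : ∀ e, m ≤ S.a e ∧ S.a e ≤ r ∧ m ≤ S.b e ∧ S.b e ≤ r) {s t ε : ℝ} (hs : 0 ≤ s)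
    (ht : 0 ≤ t) (hε : 0 ≤ ε) (x y : ℝ) (e : E) :
    S.edgeWeight (x + s) (y + t) e ≤
      r ^ (s + t) * m ^ (-(2 * ε)) * S.edgeWeight (x + ε) (y + ε) e := by
  obtain ⟨ha, ha', hb, hb'⟩ := hr e
  have ha0 := (S.a_mem e).1
  have hb0 := (S.b_mem e).1
  have hr0 : 0 < r := hm.trans_le (ha.trans ha')
  have key : ∀ {a : ℝ}, 0 < a → m ≤ a → a ≤ r → ∀ {s : ℝ}, 0 ≤ s → ∀ x,
      a ^ (x + s) ≤ r ^ s * m ^ (-ε) * a ^ (x + ε) := by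
    intro a ha0 ha ha' s hs x
    have h : a ^ (x + s) = a ^ s * a ^ (-ε) * a ^ (x + ε) := by
      rw [← Real.rpow_add ha0, ← Real.rpow_add ha0]; congr 1; ring
    rw [h]
    refine mul_le_mul_of_nonneg_right ?_ (Real.rpow_nonneg ha0.le _)
    exact mul_le_mul (Real.rpow_le_rpow ha0.le ha' hs)
      (Real.rpow_le_rpow_of_nonpos hm ha (by linarith)) (Real.rpow_nonneg ha0.le _)
      (Real.rpow_nonneg hr0.le _)
  have h1 := key ha0 ha ha' hs x
  have h2 := key hb0 hb hb' ht y
  calc S.edgeWeight (x + s) (y + t) e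
      ≤ (r ^ s * m ^ (-ε) * S.a e ^ (x + ε)) * (r ^ t * m ^ (-ε) * S.b e ^ (y + ε)) :=
        mul_le_mul h1 h2 (Real.rpow_nonneg hb0.le _) (by positivity)
    _ = (r ^ s * r ^ t) * (m ^ (-ε) * m ^ (-ε)) * S.edgeWeight (x + ε) (y + ε) e := by
        rw [edgeWeight]; ring
    _ = _ := by rw [← Real.rpow_add hr0, ← Real.rpow_add hm]; congr 3; ring

variable [Fintype E]

theorem image_cut_subset (hdiag : ∀ e, S.diag e = true) (hX : S.IsGDAttractor X) {n : ℕ} {δ : ℝ}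
    {v : V} {Q : Piece V} (hQ : Q ∈ S.cut n δ (Piece.one v)) : Q.map '' X Q.vtx ⊆ X v := by
  have h := cut_image_subset hdiag hX hQ
  rwa [Piece.map_one, Set.image_id] at h

theorem length_cut_filter_le (hdiag : ∀ e, S.diag e = true) (hROSC : S.ROSC)
    (hX : S.IsGDAttractor X) (hsq : ∀ v, X v ⊆ Icc 0 1 ×ˢ Icc 0 1) {δ₁ δ₂ : ℝ} (h1 : 0 < δ₁)
    (h2 : 0 < δ₂) (n : ℕ) (v : V) (c : Piece V → Bool)
    (hc : ∀ Q ∈ S.cut n 0 (Piece.one v), c Q = true → 1 / 2 * δ₁ ≤ |Q.u| ∧ 1 / 2 * δ₂ ≤ |Q.w|) :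
    ((S.cut n 0 (Piece.one v)).filter c).length ≤ (meshIdx (Prod.fst '' X v) δ₁).ncard *
      (meshIdx (Prod.snd '' X v) δ₂).ncard * latticeBound (1 / 2) ^ 2 := by
  set L := (S.cut n 0 (Piece.one v)).filter c with hL
  have hmem : ∀ Q ∈ L, Q ∈ S.cut n 0 (Piece.one v) ∧ c Q = true := fun Q hQ =>
    List.mem_filter.mp hQ
  have hpair := (cut_openRect hdiag hROSC (n := n) (δ := 0) (P := Piece.one v)
    (by simp [Piece.one]) (by simp [Piece.one])).2.filter c
  have hsub : ∀ Q ∈ L, Q.map '' X Q.vtx ⊆ X v := fun Q hQ =>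
    image_cut_subset hdiag hX (hmem Q hQ).1
  have hsum := sum_rectIdx_ncard_le (by norm_num : (0 : ℝ) < 1 / 2) h1 h2 L X (X v) hpair
    (fun Q hQ => (hc Q (hmem Q hQ).1 (hmem Q hQ).2).1)
    (fun Q hQ => (hc Q (hmem Q hQ).1 (hmem Q hQ).2).2) hsq (hsq v) hsub
  have hlen : L.length ≤ (L.map fun Q => (rectIdx (Q.map '' X Q.vtx) δ₁ δ₂).ncard).sum := by
    have h := List.length_le_sum_of_one_le
      (L.map fun Q => (rectIdx (Q.map '' X Q.vtx) δ₁ δ₂).ncard) (by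
        intro i hi
        obtain ⟨Q, hQ, rfl⟩ := List.mem_map.mp hi
        exact rectIdx_ncard_pos h1 h2 ((hsub Q hQ).trans (hsq v)) ((hX.1 Q.vtx).1.image _))
    rwa [List.length_map] at h
  exact (hlen.trans hsum).trans (Nat.mul_le_mul_right _ (rectIdx_ncard_le_mul h1 h2 (hsq v)))

theorem exists_pathSum_le (hdiag : ∀ e, S.diag e = true) (hROSC : S.ROSC)
    (hX : S.IsGDAttractor X) (hsq : ∀ v, X v ⊆ Icc 0 1 ×ˢ Icc 0 1) (hτA : 0 ≤ τA) (hτB : 0 ≤ τB)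
    (hA : MeshExponent (fun v => Prod.fst '' X v) τA)
    (hB : MeshExponent (fun v => Prod.snd '' X v) τB) {ε : ℝ} (hε : 0 < ε) :
    ∃ C, ∀ k v, S.pathSum (S.edgeWeight (τA + ε) (τB + ε)) k v ≤ C := by
  obtain ⟨CA, hCA, hA⟩ := hA (ε / 2) (by positivity) 1 le_rfl
  obtain ⟨CB, hCB, hB⟩ := hB (ε / 2) (by positivity) 1 le_rfl
  set q : ℝ := (1 / 2) ^ (ε / 2) with hq
  have hq0 : 0 < q := by positivity
  have hq1 : q < 1 := Real.rpow_lt_one (by norm_num) (by norm_num) (by positivity)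
  have hgeo : Summable fun n : ℕ => q ^ n := summable_geometric_of_lt_one hq0.le hq1
  have hsummable : Summable fun i : ℕ × ℕ => q ^ i.1 * q ^ i.2 :=
    hgeo.mul_of_nonneg hgeo (fun n => by positivity) (fun n => by positivity)
  set K : ℝ := CA * CB * (latticeBound (1 / 2) : ℝ) ^ 2 with hK
  have hK0 : 0 ≤ K := by positivity
  refine ⟨K * ∑' i : ℕ × ℕ, q ^ i.1 * q ^ i.2, fun k v => ?_⟩
  have hclass : ∀ t : ℝ, ∃ i : ℕ, 0 < t → t ≤ 1 → (1 / 2 : ℝ) ^ (i + 1) < t ∧ t ≤ (1 / 2) ^ i := by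
    intro t
    by_cases h : 0 < t ∧ t ≤ 1
    · obtain ⟨i, hi⟩ := exists_nat_pow_near_of_lt_one h.1 h.2 (by norm_num : (0 : ℝ) < 1 / 2)
        (by norm_num)
      exact ⟨i, fun _ _ => hi⟩
    · exact ⟨0, fun h1 h2 => absurd ⟨h1, h2⟩ h⟩
  choose c hc using hclass
  set L := S.cut k 0 (Piece.one v) with hL
  have hQ : ∀ Q ∈ L, (0 < |Q.u| ∧ |Q.u| ≤ 1) ∧ (0 < |Q.w| ∧ |Q.w| ≤ 1) := by
    intro Q hQ
    simpa [Piece.one] using cut_abs_pos (by simp [Piece.one]) (by simp [Piece.one]) hQ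
  have hsum := sum_cut_zero (S := S) (τA + ε) (τB + ε) k (Piece.one v)
  have hone : pieceWeight (τA + ε) (τB + ε) (Piece.one v) = 1 := by simp [pieceWeight, Piece.one]
  rw [hone, one_mul] at hsum
  change _ = S.pathSum (S.edgeWeight (τA + ε) (τB + ε)) k v at hsum
  set cl : Piece V → ℕ × ℕ := fun Q => (c |Q.u|, c |Q.w|) with hcl
  rw [← hsum, sum_map_eq_sum_filter L _ cl (L.map cl).toFinset
    (fun Q hQ => List.mem_toFinset.mpr (List.mem_map_of_mem hQ))]
  have hpart : ∀ i : ℕ × ℕ, ((L.filter fun Q => decide (cl Q = i)).map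
      (pieceWeight (τA + ε) (τB + ε))).sum ≤ K * (q ^ i.1 * q ^ i.2) := by
    rintro ⟨i, j⟩
    set δ₁ : ℝ := (1 / 2) ^ i with hδ₁
    set δ₂ : ℝ := (1 / 2) ^ j with hδ₂
    have h1 : 0 < δ₁ := by positivity
    have h2 : 0 < δ₂ := by positivity
    have h1' : δ₁ ≤ 1 := pow_le_one₀ (by norm_num) (by norm_num)
    have h2' : δ₂ ≤ 1 := pow_le_one₀ (by norm_num) (by norm_num)
    have hcQ : ∀ Q ∈ L, decide (cl Q = (i, j)) = true →
        (1 / 2 * δ₁ < |Q.u| ∧ |Q.u| ≤ δ₁) ∧ (1 / 2 * δ₂ < |Q.w| ∧ |Q.w| ≤ δ₂) := by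
      intro Q hQL hQc
      have hQc := of_decide_eq_true hQc
      simp only [hcl, Prod.mk.injEq] at hQc
      have hu := hc |Q.u| (hQ Q hQL).1.1 (hQ Q hQL).1.2
      have hw := hc |Q.w| (hQ Q hQL).2.1 (hQ Q hQL).2.2
      rw [hQc.1, pow_succ'] at hu
      rw [hQc.2, pow_succ'] at hw
      exact ⟨hu, hw⟩
    have hlen := length_cut_filter_le hdiag hROSC hX hsq h1 h2 k v
      (fun Q => decide (cl Q = (i, j)))
      (fun Q hQL hQc => ⟨(hcQ Q hQL hQc).1.1.le, (hcQ Q hQL hQc).2.1.le⟩)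
    have hlen' : (((L.filter fun Q => decide (cl Q = (i, j))).length : ℕ) : ℝ) ≤
        (meshIdx (Prod.fst '' X v) δ₁).ncard * (meshIdx (Prod.snd '' X v) δ₂).ncard *
          (latticeBound (1 / 2) : ℝ) ^ 2 := by exact_mod_cast hlen
    have hAv := (hA v δ₁ h1 h1').1
    have hBv := (hB v δ₂ h2 h2').1
    have hterm := List.sum_le_card_nsmul ((L.filter fun Q => decide (cl Q = (i, j))).map
      (pieceWeight (τA + ε) (τB + ε))) (δ₁ ^ (τA + ε) * δ₂ ^ (τB + ε)) (by
        intro t ht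
        obtain ⟨Q, hQf, rfl⟩ := List.mem_map.mp ht
        obtain ⟨hQL, hQc⟩ := List.mem_filter.mp hQf
        have h := hcQ Q hQL hQc
        exact mul_le_mul (Real.rpow_le_rpow (abs_nonneg _) h.1.2 (by positivity))
          (Real.rpow_le_rpow (abs_nonneg _) h.2.2 (by positivity))
          (Real.rpow_nonneg (abs_nonneg _) _) (Real.rpow_nonneg h1.le _))
    rw [List.length_map, nsmul_eq_mul] at hterm
    have hq1 : δ₁ ^ (-(τA + ε / 2)) * δ₁ ^ (τA + ε) = q ^ i := by
      rw [← Real.rpow_add h1, hδ₁, hq, ← Real.rpow_natCast, ← Real.rpow_natCast,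
        ← Real.rpow_mul (by norm_num), ← Real.rpow_mul (by norm_num)]
      congr 1; ring
    have hq2 : δ₂ ^ (-(τB + ε / 2)) * δ₂ ^ (τB + ε) = q ^ j := by
      rw [← Real.rpow_add h2, hδ₂, hq, ← Real.rpow_natCast, ← Real.rpow_natCast,
        ← Real.rpow_mul (by norm_num), ← Real.rpow_mul (by norm_num)]
      congr 1; ring
    have hpos : 0 ≤ δ₁ ^ (τA + ε) * δ₂ ^ (τB + ε) :=
      mul_nonneg (Real.rpow_nonneg h1.le _) (Real.rpow_nonneg h2.le _)
    have hpos2 : 0 ≤ CA * δ₁ ^ (-(τA + ε / 2)) := mul_nonneg hCA.le (Real.rpow_nonneg h1.le _)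
    calc _ ≤ _ := hterm
      _ ≤ (CA * δ₁ ^ (-(τA + ε / 2)) * (CB * δ₂ ^ (-(τB + ε / 2))) *
            (latticeBound (1 / 2) : ℝ) ^ 2) * (δ₁ ^ (τA + ε) * δ₂ ^ (τB + ε)) := by
          refine mul_le_mul_of_nonneg_right (hlen'.trans ?_) hpos
          gcongr
      _ = K * ((δ₁ ^ (-(τA + ε / 2)) * δ₁ ^ (τA + ε)) *
            (δ₂ ^ (-(τB + ε / 2)) * δ₂ ^ (τB + ε))) := by rw [hK]; ring
      _ = _ := by rw [hq1, hq2]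
  calc _ ≤ ∑ i ∈ (L.map cl).toFinset, K * (q ^ i.1 * q ^ i.2) :=
        Finset.sum_le_sum fun i _ => hpart i
    _ = K * ∑ i ∈ (L.map cl).toFinset, q ^ i.1 * q ^ i.2 := by rw [Finset.mul_sum]
    _ ≤ _ := mul_le_mul_of_nonneg_left
        (hsummable.sum_le_tsum _ fun i _ => by positivity) hK0

theorem add_le_of_specRad_eq_one (hdiag : ∀ e, S.diag e = true) (hROSC : S.ROSC)
    (hX : S.IsGDAttractor X) (hsq : ∀ v, X v ⊆ Icc 0 1 ×ˢ Icc 0 1) {m r : ℝ} (hm : 0 < m)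
    (hr0 : 0 < r) (hr1 : r < 1) (hr : ∀ e, m ≤ S.a e ∧ S.a e ≤ r ∧ m ≤ S.b e ∧ S.b e ≤ r)
    (hτA : 0 ≤ τA) (hτB : 0 ≤ τB) (hA : MeshExponent (fun v => Prod.fst '' X v) τA)
    (hB : MeshExponent (fun v => Prod.snd '' X v) τB) {p : E → ℝ} {s t : ℝ} (hs : 0 ≤ s)
    (ht : 0 ≤ t) (hF : specRad (S.Fmat p 0 (τA + s) (τB + t)) = 1) : s + t ≤ 0 := by
  by_contra! hst
  have hlim : Tendsto (fun ε : ℝ => r ^ (s + t) * m ^ (-(2 * ε))) (nhdsWithin 0 (Ioi 0))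
      (nhds (r ^ (s + t))) := by
    have hcont : Continuous fun ε : ℝ => r ^ (s + t) * m ^ (-(2 * ε)) :=
      continuous_const.mul (continuous_const.rpow (by fun_prop) fun _ => Or.inl hm.ne')
    have h := hcont.tendsto 0
    simp only [mul_zero, neg_zero, Real.rpow_zero, mul_one] at h
    exact h.mono_left nhdsWithin_le_nhds
  obtain ⟨ε, hε1, hε⟩ := ((hlim.eventually_lt_const (Real.rpow_lt_one hr0.le hr1 hst)).and
    self_mem_nhdsWithin).exists
  have hε : 0 < ε := hε
  set θ := r ^ (s + t) * m ^ (-(2 * ε)) with hθ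
  have hθ0 : 0 < θ := mul_pos (Real.rpow_pos_of_pos hr0 _) (Real.rpow_pos_of_pos hm _)
  obtain ⟨C, hC⟩ := exists_pathSum_le hdiag hROSC hX hsq hτA hτB hA hB hε
  obtain ⟨κ, hκ1, hκ2⟩ := exists_between hε1
  have hκ0 := hθ0.trans hκ1
  have hbound : ∀ k, mnorm (S.Fmat p 0 (τA + s) (τB + t) ^ k) ≤ θ ^ k * (Fintype.card E * C) := by
    intro k
    rw [mnorm_Fmat_pow]
    calc _ ≤ ∑ _e : E, θ ^ k * C := Finset.sum_le_sum fun e _ =>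
          (pathSum_le_pow_mul S hθ0.le (S.edgeWeight_pos _ _) (S.edgeWeight_pos _ _)
            (edgeWeight_add_le hm hr hs ht hε.le τA τB) k _).trans
            (mul_le_mul_of_nonneg_left (hC k _) (by positivity))
      _ = _ := by rw [Finset.sum_const, Finset.card_univ, nsmul_eq_mul]; ring
  have hto : Tendsto (fun k : ℕ => (θ / κ) ^ k * (Fintype.card E * C)) atTop (nhds 0) := by
    simpa using (tendsto_pow_atTop_nhds_zero_of_lt_one (by positivity)
      ((div_lt_one hκ0).mpr hκ1)).mul_const (Fintype.card E * C)
  obtain ⟨k, hk1, hk2⟩ := ((frequently_lt_mnorm hF hκ0 hκ2).and_eventually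
    (hto.eventually_lt_const one_pos)).exists
  have h := hk1.trans_le (hbound k)
  rw [div_pow, div_mul_eq_mul_div, div_lt_one (by positivity)] at hk2
  linarith

end BoxLikeGIFS

namespace BoxLikeGIFS

variable {V E : Type*} [Fintype E] {S : BoxLikeGIFS V E} {X : V → Set (ℝ × ℝ)}
  {τA τB m r : ℝ} {p : E → ℝ}

/-! ### Bounds for the box counts -/

theorem cut_one_sides (hm : 0 < m)
    (hr : ∀ e, m ≤ S.a e ∧ S.a e ≤ r ∧ m ≤ S.b e ∧ S.b e ≤ r) (hm1 : m ≤ 1) {n : ℕ} {δ : ℝ}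
    (hδ1 : δ < 1) (hn : r ^ n < δ) {v : V} {Q : Piece V}
    (hQ : Q ∈ S.cut n δ (Piece.one v)) :
    (0 < |Q.u| ∧ 0 < |Q.w|) ∧ m * δ ≤ min |Q.u| |Q.w| ∧ min |Q.u| |Q.w| < δ := by
  have h := cut_abs_pos (by simp [Piece.one]) (by simp [Piece.one]) hQ
  exact ⟨⟨h.1.1, h.2.1⟩, cut_sides hm hr (by simp [Piece.one]; nlinarith)
    (by simpa [Piece.one] using hn) hQ⟩

theorem exists_boxCount_le [Finite V] (hSC : S.StronglyConnected)
    (hdiag : ∀ e, S.diag e = true) (hX : S.IsGDAttractor X) (hsq : ∀ v, X v ⊆ Icc 0 1 ×ˢ Icc 0 1) (hm : 0 < m) (hm1 : m ≤ 1)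
    (hr0 : 0 < r) (hr1 : r < 1) (hr : ∀ e, m ≤ S.a e ∧ S.a e ≤ r ∧ m ≤ S.b e ∧ S.b e ≤ r)
    (hA : MeshExponent (fun v => Prod.fst '' X v) τA)
    (hB : MeshExponent (fun v => Prod.snd '' X v) τB) {γA γB : ℝ}
    (hγA : specRad (S.Fmat p 0 τA (γA - τA)) = 1) (hγB : specRad (S.Fmat p 0 (γB - τB) τB) = 1)
    {ε : ℝ} (hε : 0 < ε) : ∃ C > 0, ∀ v δ, 0 < δ → δ < 1 →
      (boxCount (X v) δ : ℝ) ≤ C * δ ^ (-(max γA γB + 2 * ε)) := by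
  have hθ0 : 0 < r ^ (ε + ε) := Real.rpow_pos_of_pos hr0 _
  have hθ1 : r ^ (ε + ε) < 1 := Real.rpow_lt_one hr0.le hr1 (by positivity)
  have hedge : ∀ x y e, S.edgeWeight (x + ε) (y + ε) e ≤ r ^ (ε + ε) * S.edgeWeight x y e := by
    intro x y e
    simpa using edgeWeight_add_le hm hr hε.le hε.le le_rfl x y e
  obtain ⟨DA, hDA, hsumA⟩ := exists_sum_pathSum_le hSC hγA hθ0 hθ1 (S.edgeWeight_pos _ _)
    (hedge τA (γA - τA))
  obtain ⟨DB, hDB, hsumB⟩ := exists_sum_pathSum_le hSC hγB hθ0 hθ1 (S.edgeWeight_pos _ _)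
    (hedge (γB - τB) τB)
  have hR : 1 / m ≥ 1 := by rwa [ge_iff_le, one_le_div hm]
  obtain ⟨CA, hCA, hA⟩ := hA ε hε (1 / m) hR
  obtain ⟨CB, hCB, hB⟩ := hB ε hε (1 / m) hR
  set KA := 9 * CA * m ^ (-|γA - τA + ε|) with hKA
  set KB := 9 * CB * m ^ (-|γB - τB + ε|) with hKB
  have hKA0 : 0 < KA := by positivity
  have hKB0 : 0 < KB := by positivity
  refine ⟨KA * DA + KB * DB, by positivity, fun v δ hδ hδ1 => ?_⟩
  obtain ⟨n, hn⟩ := exists_pow_lt_of_lt_one hδ hr1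
  set L := S.cut n δ (Piece.one v) with hL
  set t : ℝ := δ ^ (-(max γA γB + 2 * ε)) with ht
  have ht0 : 0 < t := Real.rpow_pos_of_pos hδ _
  have hcover : boxCount (X v) δ ≤
      (L.map fun Q => (rectIdx (Q.map '' X Q.vtx) δ δ).ncard).sum := by
    rw [boxCount_eq_ncard]
    refine ncard_le_sum_map L _ (fun Q hQ => rectIdx_finite hδ hδ
      ((image_cut_subset hdiag hX hQ).trans (hsq v))) ?_
    rintro k ⟨z, hz, hzk⟩
    have hz' : z ∈ (Piece.one v).map '' X (Piece.one v).vtx := by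
      rw [Piece.map_one, Set.image_id]; exact hz
    obtain ⟨Q, hQ, hzQ⟩ := exists_mem_cut hdiag hX (n := n) (δ := δ) hz'
    exact ⟨Q, hQ, z, hzQ, hzk⟩
  have hpiece : ∀ Q ∈ L, ((rectIdx (Q.map '' X Q.vtx) δ δ).ncard : ℝ) ≤
      t * KA * pieceWeight (τA + ε) (γA - τA + ε) Q +
      t * KB * pieceWeight (γB - τB + ε) (τB + ε) Q := by
    intro Q hQ
    obtain ⟨⟨hu, hw⟩, hmin, hmin'⟩ := cut_one_sides hm hr hm1 hδ1 hn hQ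
    have hQY := (image_cut_subset hdiag hX hQ).trans (hsq v)
    have hδu : δ / |Q.u| ≤ 1 / m := by
      rw [div_le_div_iff₀ hu hm]; linarith [min_le_left |Q.u| |Q.w|]
    have hδw : δ / |Q.w| ≤ 1 / m := by
      rw [div_le_div_iff₀ hw hm]; linarith [min_le_right |Q.u| |Q.w|]
    have hexp : ∀ s ≤ max γA γB, δ ^ (-(s + 2 * ε)) ≤ t := fun s hs =>
      Real.rpow_le_rpow_of_exponent_ge hδ hδ1.le (by linarith)
    have hposA : 0 ≤ t * KA * pieceWeight (τA + ε) (γA - τA + ε) Q :=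
      mul_nonneg (by positivity) (pieceWeight_nonneg _ _ _)
    have hposB : 0 ≤ t * KB * pieceWeight (γB - τB + ε) (τB + ε) Q :=
      mul_nonneg (by positivity) (pieceWeight_nonneg _ _ _)
    rcases le_total |Q.w| |Q.u| with hwu | huw
    · rw [min_eq_right hwu] at hmin hmin'
      have h1 : ((rectIdx (Q.map '' X Q.vtx) δ δ).ncard : ℝ) ≤
          (meshIdx (Prod.fst '' X Q.vtx) (δ / |Q.u|)).ncard * 9 := by
        exact_mod_cast rectIdx_piece_le_fst hδ (hsq _) hQY hu hmin'.le
      have h2 := (hA Q.vtx (δ / |Q.u|) (by positivity) hδu).1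
      have h3 := div_rpow_neg_le hm hu hδ hmin hmin'.le (τA + ε) (γA - τA + ε)
      rw [show τA + ε + (γA - τA + ε) = γA + 2 * ε by ring] at h3
      have hpw := pieceWeight_nonneg (τA + ε) (γA - τA + ε) Q
      refine le_trans ?_ (le_add_of_nonneg_right hposB)
      calc _ ≤ (CA * (δ / |Q.u|) ^ (-(τA + ε))) * 9 := by linarith
        _ ≤ CA * (m ^ (-|γA - τA + ε|) * (δ ^ (-(γA + 2 * ε)) *
              pieceWeight (τA + ε) (γA - τA + ε) Q)) * 9 := by
            gcongr; exact h3
        _ = KA * δ ^ (-(γA + 2 * ε)) * pieceWeight (τA + ε) (γA - τA + ε) Q := by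
            rw [hKA]; ring
        _ ≤ KA * t * pieceWeight (τA + ε) (γA - τA + ε) Q := by
            gcongr; exact hexp _ (le_max_left _ _)
        _ = _ := by ring
    · rw [min_eq_left huw] at hmin hmin'
      have h1 : ((rectIdx (Q.map '' X Q.vtx) δ δ).ncard : ℝ) ≤
          (meshIdx (Prod.snd '' X Q.vtx) (δ / |Q.w|)).ncard * 9 := by
        exact_mod_cast rectIdx_piece_le_snd hδ (hsq _) hQY hw hmin'.le
      have h2 := (hB Q.vtx (δ / |Q.w|) (by positivity) hδw).1
      have h3 := div_rpow_neg_le hm hw hδ hmin hmin'.le (τB + ε) (γB - τB + ε)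
      rw [show τB + ε + (γB - τB + ε) = γB + 2 * ε by ring, mul_comm (|Q.w| ^ (τB + ε))] at h3
      have hpw := pieceWeight_nonneg (γB - τB + ε) (τB + ε) Q
      refine le_trans ?_ (le_add_of_nonneg_left hposA)
      calc _ ≤ (CB * (δ / |Q.w|) ^ (-(τB + ε))) * 9 := by linarith
        _ ≤ CB * (m ^ (-|γB - τB + ε|) * (δ ^ (-(γB + 2 * ε)) *
              pieceWeight (γB - τB + ε) (τB + ε) Q)) * 9 := by
            gcongr; exact h3
        _ = KB * δ ^ (-(γB + 2 * ε)) * pieceWeight (γB - τB + ε) (τB + ε) Q := by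
            rw [hKB]; ring
        _ ≤ KB * t * pieceWeight (γB - τB + ε) (τB + ε) Q := by
            gcongr; exact hexp _ (le_max_right _ _)
        _ = _ := by ring
  have hone : ∀ x y, pieceWeight x y (Piece.one v) = 1 := fun x y => by
    simp [pieceWeight, Piece.one]
  have hcutA := sum_cut_le (S := S) (τA + ε) (γA - τA + ε) n δ (Piece.one v)
  have hcutB := sum_cut_le (S := S) (γB - τB + ε) (τB + ε) n δ (Piece.one v)
  rw [hone, one_mul] at hcutA hcutB
  have hcutA' := hcutA.trans (hsumA (n + 1) _)
  have hcutB' := hcutB.trans (hsumB (n + 1) _)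
  calc (boxCount (X v) δ : ℝ)
      ≤ (L.map fun Q => ((rectIdx (Q.map '' X Q.vtx) δ δ).ncard : ℝ)).sum := by
        have h : (boxCount (X v) δ : ℝ) ≤
          ((L.map fun Q => (rectIdx (Q.map '' X Q.vtx) δ δ).ncard).sum : ℕ) := by
            exact_mod_cast hcover
        rw [Nat.cast_list_sum, List.map_map] at h
        exact h
    _ ≤ (L.map fun Q => t * KA * pieceWeight (τA + ε) (γA - τA + ε) Q +
          t * KB * pieceWeight (γB - τB + ε) (τB + ε) Q).sum := List.sum_le_sum hpiece
    _ = t * KA * (L.map (pieceWeight (τA + ε) (γA - τA + ε))).sum +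
          t * KB * (L.map (pieceWeight (γB - τB + ε) (τB + ε))).sum := by
        rw [List.sum_map_add, List.sum_map_mul_left, List.sum_map_mul_left]
    _ ≤ t * KA * DA + t * KB * DB := by gcongr
    _ = _ := by ring

theorem exists_le_boxCount [Finite V] (hSC : S.StronglyConnected)
    (hdiag : ∀ e, S.diag e = true) (hROSC : S.ROSC) (hX : S.IsGDAttractor X) (hsq : ∀ v, X v ⊆ Icc 0 1 ×ˢ Icc 0 1) (hm : 0 < m)
    (hm1 : m ≤ 1) (hr0 : 0 < r) (hr1 : r < 1)
    (hr : ∀ e, m ≤ S.a e ∧ S.a e ≤ r ∧ m ≤ S.b e ∧ S.b e ≤ r)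
    (hA : MeshExponent (fun v => Prod.fst '' X v) τA)
    (hB : MeshExponent (fun v => Prod.snd '' X v) τB) {x y : ℝ} (hx : x ≤ τA) (hy : y ≤ τB)
    (hF : specRad (S.Fmat p 0 x y) = 1) {ε : ℝ} (hε : 0 < ε) :
    ∃ C > 0, ∀ v δ, 0 < δ → δ < 1 → δ ^ (-(x + y - 2 * ε)) ≤ C * boxCount (X v) δ := by
  have hθ0 : 0 < r ^ (ε + ε) := Real.rpow_pos_of_pos hr0 _
  have hθ1 : r ^ (ε + ε) < 1 := Real.rpow_lt_one hr0.le hr1 (by positivity)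
  obtain ⟨h, H, hh1, hhH, hsub⟩ := exists_subinvariant hSC hF hθ0 hθ1
    (S.edgeWeight_pos (x - ε) (y - ε)) fun e => by
      simpa using edgeWeight_add_le hm hr hε.le hε.le le_rfl (x - ε) (y - ε) e
  have hR : 1 / m ≥ 1 := by rwa [ge_iff_le, one_le_div hm]
  obtain ⟨CA, hCA, hA⟩ := hA ε hε (1 / m) hR
  obtain ⟨CB, hCB, hB⟩ := hB ε hε (1 / m) hR
  set KA := m ^ (-|y - ε| + (x - ε - (τA - ε))) * (CA * 3) with hKA
  set KB := m ^ (-|x - ε| + (y - ε - (τB - ε))) * (CB * 3) with hKB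
  have hKA0 : 0 < KA := by positivity
  have hKB0 : 0 < KB := by positivity
  refine ⟨(KA + KB) * |H| * (latticeBound m : ℝ) ^ 2 + 1, by positivity, fun v δ hδ hδ1 => ?_⟩
  have hH : 0 ≤ H := zero_le_one.trans ((hh1 v).trans (hhH v))
  rw [abs_of_nonneg hH]
  obtain ⟨n, hn⟩ := exists_pow_lt_of_lt_one hδ hr1
  set L := S.cut n δ (Piece.one v) with hL
  set t : ℝ := δ ^ (-(x + y - 2 * ε)) with ht
  have ht0 : 0 < t := Real.rpow_pos_of_pos hδ _
  have hpiece : ∀ Q ∈ L, t * pieceWeight (x - ε) (y - ε) Q ≤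
      (KA + KB) * ((rectIdx (Q.map '' X Q.vtx) δ δ).ncard : ℝ) := by
    intro Q hQ
    obtain ⟨⟨hu, hw⟩, hmin, hmin'⟩ := cut_one_sides hm hr hm1 hδ1 hn hQ
    have hQY := (image_cut_subset hdiag hX hQ).trans (hsq v)
    have hδu : δ / |Q.u| ≤ 1 / m := by
      rw [div_le_div_iff₀ hu hm]; linarith [min_le_left |Q.u| |Q.w|]
    have hδw : δ / |Q.w| ≤ 1 / m := by
      rw [div_le_div_iff₀ hw hm]; linarith [min_le_right |Q.u| |Q.w|]
    set N : ℝ := ((rectIdx (Q.map '' X Q.vtx) δ δ).ncard : ℝ) with hN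
    have hN0 : 0 ≤ N := Nat.cast_nonneg _
    rcases le_total |Q.w| |Q.u| with hwu | huw
    · rw [min_eq_right hwu] at hmin hmin'
      have h1 : ((meshIdx (Prod.fst '' X Q.vtx) (δ / |Q.u|)).ncard : ℝ) ≤ N * 3 := by
        rw [hN]; exact_mod_cast meshIdx_fst_le_rectIdx_piece hδ hQY hu
      have h2 := (hA Q.vtx (δ / |Q.u|) (by positivity) hδu).2
      have h3 := le_div_rpow_neg hm hu hδ hmin hmin'.le hwu (sub_le_sub_right hx ε) (y - ε)
      rw [show x - ε + (y - ε) = x + y - 2 * ε by ring] at h3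
      calc _ ≤ m ^ (-|y - ε| + (x - ε - (τA - ε))) * (δ / |Q.u|) ^ (-(τA - ε)) := h3
        _ ≤ m ^ (-|y - ε| + (x - ε - (τA - ε))) * (CA * (N * 3)) := by
            gcongr; exact h2.trans (by gcongr)
        _ = KA * N := by rw [hKA]; ring
        _ ≤ _ := by gcongr; linarith
    · rw [min_eq_left huw] at hmin hmin'
      have h1 : ((meshIdx (Prod.snd '' X Q.vtx) (δ / |Q.w|)).ncard : ℝ) ≤ N * 3 := by
        rw [hN]; exact_mod_cast meshIdx_snd_le_rectIdx_piece hδ hQY hw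
      have h2 := (hB Q.vtx (δ / |Q.w|) (by positivity) hδw).2
      have h3 := le_div_rpow_neg hm hw hδ hmin hmin'.le huw (sub_le_sub_right hy ε) (x - ε)
      rw [show y - ε + (x - ε) = x + y - 2 * ε by ring, mul_comm (|Q.w| ^ (y - ε))] at h3
      calc _ ≤ m ^ (-|x - ε| + (y - ε - (τB - ε))) * (δ / |Q.w|) ^ (-(τB - ε)) := h3
        _ ≤ m ^ (-|x - ε| + (y - ε - (τB - ε))) * (CB * (N * 3)) := by
            gcongr; exact h2.trans (by gcongr)
        _ = KB * N := by rw [hKB]; ring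
        _ ≤ _ := by gcongr; linarith
  have hcut := le_sum_cut hsub n δ (Piece.one v)
  have hone : pieceWeight (x - ε) (y - ε) (Piece.one v) = 1 := by simp [pieceWeight, Piece.one]
  rw [hone, one_mul] at hcut
  have hmass : 1 ≤ (L.map fun Q => H * pieceWeight (x - ε) (y - ε) Q).sum := by
    refine (hh1 _).trans (hcut.trans (List.sum_le_sum fun Q _ => ?_))
    rw [mul_comm]
    exact mul_le_mul_of_nonneg_right (hhH _) (pieceWeight_nonneg _ _ _)
  rw [List.sum_map_mul_left] at hmass
  have hL' := (cut_openRect hdiag hROSC (n := n) (δ := δ) (P := Piece.one v)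
    (by simp [Piece.one]) (by simp [Piece.one])).2
  have hcount := sum_rectIdx_ncard_le hm hδ hδ L X (X v) hL'
    (fun Q hQ => (cut_one_sides hm hr hm1 hδ1 hn hQ).2.1.trans (min_le_left _ _))
    (fun Q hQ => (cut_one_sides hm hr hm1 hδ1 hn hQ).2.1.trans (min_le_right _ _))
    hsq (hsq v) (fun Q hQ => image_cut_subset hdiag hX hQ)
  rw [← boxCount_eq_ncard] at hcount
  have hcount' : (L.map fun Q => ((rectIdx (Q.map '' X Q.vtx) δ δ).ncard : ℝ)).sum ≤
      boxCount (X v) δ * (latticeBound m : ℝ) ^ 2 := by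
    have h : (((L.map fun Q => (rectIdx (Q.map '' X Q.vtx) δ δ).ncard).sum : ℕ) : ℝ) ≤
        boxCount (X v) δ * (latticeBound m : ℝ) ^ 2 := by exact_mod_cast hcount
    rw [Nat.cast_list_sum, List.map_map] at h
    exact h
  calc t ≤ t * (H * (L.map (pieceWeight (x - ε) (y - ε))).sum) :=
        le_mul_of_one_le_right ht0.le hmass
    _ = H * (L.map fun Q => t * pieceWeight (x - ε) (y - ε) Q).sum := by
        rw [List.sum_map_mul_left]; ring
    _ ≤ H * (L.map fun Q => (KA + KB) * ((rectIdx (Q.map '' X Q.vtx) δ δ).ncard : ℝ)).sum :=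
        mul_le_mul_of_nonneg_left (List.sum_le_sum hpiece) hH
    _ ≤ H * ((KA + KB) * (boxCount (X v) δ * (latticeBound m : ℝ) ^ 2)) := by
        rw [List.sum_map_mul_left]; gcongr
    _ ≤ ((KA + KB) * H * (latticeBound m : ℝ) ^ 2 + 1) * boxCount (X v) δ := by
        rw [add_one_mul]
        have : (0 : ℝ) ≤ boxCount (X v) δ := Nat.cast_nonneg _
        linarith

end BoxLikeGIFS

/-! ### Projections of the measures -/

theorem map_compl_image_eq_zero {μ : Measure (ℝ × ℝ)} {X : Set (ℝ × ℝ)} {π : ℝ × ℝ → ℝ}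
    (hπ : Continuous π) (hX : IsCompact X) (h : μ Xᶜ = 0) : μ.map π (π '' X)ᶜ = 0 := by
  rw [Measure.map_apply hπ.measurable (hX.image hπ).measurableSet.compl]
  exact measure_mono_null (fun z hz hzX => hz ⟨z, hzX, rfl⟩) h

theorem map_ball_pos {μ : Measure (ℝ × ℝ)} {X : Set (ℝ × ℝ)} {π : ℝ × ℝ → ℝ}
    (hπ : LipschitzWith 1 π) (h : ∀ z ∈ X, ∀ ρ > 0, 0 < μ (Metric.ball z ρ)) :
    ∀ x ∈ π '' X, ∀ ρ > 0, 0 < μ.map π (Metric.ball x ρ) := by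
  rintro _ ⟨z, hz, rfl⟩ ρ hρ
  rw [Measure.map_apply hπ.continuous.measurable Metric.isOpen_ball.measurableSet]
  refine (h z hz ρ hρ).trans_le (measure_mono fun y hy => ?_)
  have := hπ.dist_le_mul y z
  rw [NNReal.coe_one, one_mul] at this
  exact lt_of_le_of_lt this hy

theorem hasBoxDim_of_specRad {V E : Type*} [Fintype V] [Fintype E] [Nonempty V]
    {S : BoxLikeGIFS V E} (hSC : S.StronglyConnected) (hROSC : S.ROSC)
    (hdiag : ∀ e : E, S.diag e = true) {X : V → Set (ℝ × ℝ)} (hX : S.IsGDAttractor X)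
    {p : E → ℝ} (hp : S.IsWeights p) {μ : V → Measure (ℝ × ℝ)} (hμ : S.IsGDMeasure p μ)
    {τA τB : ℝ} (hτA : ∀ v : V, HasLq1 ((μ v).map Prod.fst) 0 τA)
    (hτB : ∀ v : V, HasLq1 ((μ v).map Prod.snd) 0 τB) {γA γB : ℝ}
    (hγA : specRad (S.Fmat p 0 τA (γA - τA)) = 1) (hγB : specRad (S.Fmat p 0 (γB - τB) τB) = 1)
    (v : V) : HasBoxDim (X v) (max γA γB) := by
  obtain ⟨m, r, hm, hr1, hmr, hr⟩ := S.exists_ratio_bounds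
  have hr0 : 0 < r := hm.trans_le hmr
  have hm1 : m ≤ 1 := hmr.trans hr1.le
  have hr' : ∀ e, S.a e ≤ r ∧ S.b e ≤ r := fun e => ⟨(hr e).2.1, (hr e).2.2.2⟩
  have hsq := BoxLikeGIFS.attractor_subset hdiag hROSC hr0 hr1 hr' hX
  have hnull := BoxLikeGIFS.measure_compl_attractor hdiag hr0 hr1 hr' hX hp hμ
  have hpos : ∀ v, ∀ z ∈ X v, ∀ ρ > 0, 0 < μ v (Metric.ball z ρ) := fun v z hz ρ hρ =>
    BoxLikeGIFS.measure_ball_pos hdiag hROSC hr0 hr1 hr' hX hp hμ v hz hρ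
  obtain ⟨hA0, hA⟩ := meshExponent_of_hasLq1 hτA (fun v => (hX.1 v).1.image Prod.fst)
    (fun v => fst_image_subset (hsq v))
    (fun v => map_compl_image_eq_zero continuous_fst (hX.1 v).2 (hnull v))
    (fun v => map_ball_pos LipschitzWith.prod_fst (hpos v))
  obtain ⟨hB0, hB⟩ := meshExponent_of_hasLq1 hτB (fun v => (hX.1 v).1.image Prod.snd)
    (fun v => snd_image_subset (hsq v))
    (fun v => map_compl_image_eq_zero continuous_snd (hX.1 v).2 (hnull v))
    (fun v => map_ball_pos LipschitzWith.prod_snd (hpos v))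
  have hγA' : γA - τA ≤ τB := by
    by_contra! hcon
    have := BoxLikeGIFS.add_le_of_specRad_eq_one hdiag hROSC hX hsq hm hr0 hr1 hr hA0 hB0 hA hB
      (s := 0) (t := γA - τA - τB) le_rfl (by linarith)
      (by rw [add_zero, add_sub_cancel]; exact hγA)
    linarith
  have hγB' : γB - τB ≤ τA := by
    by_contra! hcon
    have := BoxLikeGIFS.add_le_of_specRad_eq_one hdiag hROSC hX hsq hm hr0 hr1 hr hA0 hB0 hA hB
      (s := γB - τB - τA) (t := 0) (by linarith) le_rfl
      (by rw [add_zero, add_sub_cancel]; exact hγB)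
    linarith
  refine tendsto_log_div_of_rpow_bounds (N := fun δ => (boxCount (X v) δ : ℝ))
    (fun ε hε => ?_) (fun ε hε => ?_)
  · have hε2 : 2 * (ε / 2) = ε := by ring
    rcases le_total γB γA with h | h
    · obtain ⟨C, hC, hb⟩ := BoxLikeGIFS.exists_le_boxCount hSC hdiag hROSC hX hsq hm hm1 hr0 hr1 hr
        hA hB le_rfl hγA' hγA (half_pos hε)
      rw [hε2, add_sub_cancel] at hb
      rw [max_eq_left h]
      exact ⟨C, hC, hb v⟩
    · obtain ⟨C, hC, hb⟩ := BoxLikeGIFS.exists_le_boxCount hSC hdiag hROSC hX hsq hm hm1 hr0 hr1 hr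
        hA hB hγB' le_rfl hγB (half_pos hε)
      rw [hε2, sub_add_cancel] at hb
      rw [max_eq_right h]
      exact ⟨C, hC, hb v⟩
  · obtain ⟨C, hC, hb⟩ := BoxLikeGIFS.exists_boxCount_le hSC hdiag hX hsq hm hm1 hr0 hr1 hr
      hA hB hγA hγB (half_pos hε)
    rw [show 2 * (ε / 2) = ε by ring] at hb
    exact ⟨C, hC, hb v⟩

end

end LqGIFS

open LqGIFS MeasureTheory Filter Set

/-- box dimensions, non-rotational case.  All `T_e` diagonal, ROSC.
For any choice of positive weights, the box dimension of each carpet `X_v` exists and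
equals `max{γ_A(0), γ_B(0)}`. -/
theorem statement4
    {V E : Type} [Fintype V] [Fintype E] [Nonempty V]
    (S : BoxLikeGIFS V E) (hSC : S.StronglyConnected) (hROSC : S.ROSC)
    (hdiag : ∀ e : E, S.diag e = true)
    (X : V → Set (ℝ × ℝ)) (hX : S.IsGDAttractor X)
    (p : E → ℝ) (hp : S.IsWeights p)
    (μ : V → Measure (ℝ × ℝ)) (hμ : S.IsGDMeasure p μ)
    (τA τB : ℝ → ℝ)
    (hτA : ∀ q : ℝ, 0 ≤ q → ∀ v : V, HasLq1 ((μ v).map Prod.fst) q (τA q))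
    (hτB : ∀ q : ℝ, 0 ≤ q → ∀ v : V, HasLq1 ((μ v).map Prod.snd) q (τB q))
    (γA γB : ℝ)
    (hγA : specRad (S.Fmat p 0 (τA 0) (γA - τA 0)) = 1)
    (hγB : specRad (S.Fmat p 0 (γB - τB 0) (τB 0)) = 1) :
    ∀ v : V, HasBoxDim (X v) (max γA γB) := by
  exact hasBoxDim_of_specRad hSC hROSC hdiag hX hp hμ (hτA 0 le_rfl) (hτB 0 le_rfl) hγA hγB
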